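/- arXiv:2511.10083 — 10 statements merged into one kernel-verified Lean document; each statement's English description precedes it below -/
import Mathlib

section
/- For every retention rule p : ℕ → [0,1] and every t ≥ 0, the series ∑_{k=0}^∞ Δᵏp(0)·tᵏ/k! converges absolutely, the finite differences satisfy |Δᵏp(0)| ≤ 2ᵏ for all k ≥ 0, and one has the identity m_p(t) = e^{−t} ∑_{n=0}^∞ p(n) tⁿ/n! = ∑_{k=0}^∞ Δᵏp(0)·tᵏ/k!. -/
open scoped BigOperators

/-- Poisson expectation `m_p(t) = e^{-t} ∑ p(n) tⁿ/n!`. -/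
noncomputable def mp (p : ℕ → ℝ) (t : ℝ) : ℝ :=
  Real.exp (-t) * ∑' n : ℕ, p n * t ^ n / (Nat.factorial n : ℝ)

/-- k-th forward finite difference of `p` at 0:  `Δᵏp(0) = ∑_{j=0}^k (-1)^j C(k,j) p(k-j)`. -/
noncomputable def fd (p : ℕ → ℝ) (k : ℕ) : ℝ :=
  ∑ j ∈ Finset.range (k + 1), (-1 : ℝ) ^ j * (Nat.choose k j : ℝ) * p (k - j)

theorem finite_difference_expansion_of_mp
    (p : ℕ → ℝ) (hp : ∀ n, 0 ≤ p n ∧ p n ≤ 1) (t : ℝ) (ht : 0 ≤ t) :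
    Summable (fun k : ℕ => |fd p k * t ^ k / (Nat.factorial k : ℝ)|) ∧
    (∀ k : ℕ, |fd p k| ≤ 2 ^ k) ∧
    mp p t = ∑' k : ℕ, fd p k * t ^ k / (Nat.factorial k : ℝ) := by
  have hf : Summable (fun n : ℕ => ‖(-t) ^ n / (Nat.factorial n : ℝ)‖) :=
    (Real.summable_pow_div_factorial (-t)).norm
  have hg : Summable (fun n : ℕ => ‖p n * t ^ n / (Nat.factorial n : ℝ)‖) := by
    refine Summable.of_nonneg_of_le (fun n => norm_nonneg _) (fun n => ?_)
      (Real.summable_pow_div_factorial t)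
    have h0 : 0 ≤ p n * t ^ n / (Nat.factorial n : ℝ) :=
      div_nonneg (mul_nonneg (hp n).1 (pow_nonneg ht n)) (Nat.cast_nonneg _)
    rw [Real.norm_of_nonneg h0]
    gcongr
    exact mul_le_of_le_one_left (pow_nonneg ht n) (hp n).2
  have key : ∀ k : ℕ, fd p k * t ^ k / (Nat.factorial k : ℝ) =
      ∑ j ∈ Finset.range (k + 1), (-t) ^ j / (Nat.factorial j : ℝ) *
        (p (k - j) * t ^ (k - j) / (Nat.factorial (k - j) : ℝ)) := by
    intro k
    unfold fd
    rw [Finset.sum_mul, Finset.sum_div]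
    refine Finset.sum_congr rfl fun j hj => ?_
    have hjk : j ≤ k := Nat.lt_succ_iff.mp (Finset.mem_range.mp hj)
    rw [Nat.cast_choose ℝ hjk, neg_pow t j]
    have h1 : (Nat.factorial k : ℝ) ≠ 0 := by positivity
    have h2 : (Nat.factorial j : ℝ) ≠ 0 := by positivity
    have h3 : (Nat.factorial (k - j) : ℝ) ≠ 0 := by positivity
    have h4 : t ^ k = t ^ j * t ^ (k - j) := by rw [← pow_add, Nat.add_sub_cancel' hjk]
    rw [h4]
    field_simp
  refine ⟨?_, ?_, ?_⟩
  · have h := summable_norm_sum_mul_range_of_summable_norm hf hg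
    simp_rw [← key, Real.norm_eq_abs] at h
    exact h
  · intro k
    unfold fd
    refine (Finset.abs_sum_le_sum_abs _ _).trans ?_
    calc _ ≤ ∑ j ∈ Finset.range (k + 1), (Nat.choose k j : ℝ) := by
          refine Finset.sum_le_sum fun j _ => ?_
          rw [abs_mul, abs_mul, abs_pow, abs_neg, abs_one, one_pow, one_mul, Nat.abs_cast,
            abs_of_nonneg (hp _).1]
          exact mul_le_of_le_one_right (Nat.cast_nonneg _) (hp _).2
      _ = 2 ^ k := by exact_mod_cast Nat.sum_range_choose k
  · simp_rw [key]
    rw [← tsum_mul_tsum_eq_tsum_sum_range_of_summable_norm hf hg, mp, Real.exp_eq_exp_ℝ,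
      NormedSpace.exp_eq_tsum_div]
end

section
/- For every retention rule p : ℕ → [0,1], every integer K ≥ 0 and every t ≥ 0, the truncation error of the finite-difference expansion of m_p satisfies |m_p(t) − ∑_{k=0}^{K} Δᵏp(0)·tᵏ/k!| ≤ (2t)^{K+1}/(K+1)! · e^{2t}. -/
open scoped BigOperators

theorem fd_abs_le (p : ℕ → ℝ) (hp : ∀ n, 0 ≤ p n ∧ p n ≤ 1) (k : ℕ) : |fd p k| ≤ 2 ^ k := by
  unfold fd
  refine (Finset.abs_sum_le_sum_abs _ _).trans ?_
  have h2 : (2 : ℝ) ^ k = ∑ j ∈ Finset.range (k + 1), (Nat.choose k j : ℝ) := by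
    exact_mod_cast (Nat.sum_range_choose k).symm
  rw [h2]
  refine Finset.sum_le_sum fun j _ => ?_
  rw [abs_mul, abs_mul, abs_pow, abs_neg, abs_one, one_pow, one_mul, Nat.abs_cast,
    abs_of_nonneg (hp _).1]
  exact mul_le_of_le_one_right (Nat.cast_nonneg _) (hp _).2

theorem hasSum_exp_div (x : ℝ) :
    HasSum (fun n : ℕ => x ^ n / (Nat.factorial n : ℝ)) (Real.exp x) := by
  have := NormedSpace.expSeries_div_hasSum_exp (𝔸 := ℝ) x
  rwa [← Real.exp_eq_exp_ℝ] at this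

theorem mp_eq_tsum (p : ℕ → ℝ) (hp : ∀ n, 0 ≤ p n ∧ p n ≤ 1) (t : ℝ) :
    mp p t = ∑' k : ℕ, fd p k * t ^ k / (Nat.factorial k : ℝ) := by
  have h1 : Summable fun n : ℕ => ‖(-t) ^ n / (Nat.factorial n : ℝ)‖ :=
    (hasSum_exp_div (-t)).summable.norm
  have h2 : Summable fun n : ℕ => ‖p n * t ^ n / (Nat.factorial n : ℝ)‖ := by
    refine Summable.of_nonneg_of_le (fun _ => norm_nonneg _) (fun n => ?_)
      (hasSum_exp_div t).summable.norm
    rw [mul_div_assoc, norm_mul]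
    refine mul_le_of_le_one_left (norm_nonneg _) ?_
    rw [Real.norm_eq_abs, abs_of_nonneg (hp n).1]
    exact (hp n).2
  unfold mp
  rw [← (hasSum_exp_div (-t)).tsum_eq,
    tsum_mul_tsum_eq_tsum_sum_range_of_summable_norm h1 h2]
  refine tsum_congr fun k => ?_
  unfold fd
  rw [Finset.sum_mul, Finset.sum_div]
  refine Finset.sum_congr rfl fun j hj => ?_
  have hjk : j ≤ k := Nat.lt_succ_iff.mp (Finset.mem_range.mp hj)
  rw [Nat.cast_choose ℝ hjk]
  have e : t ^ k = t ^ j * t ^ (k - j) := by rw [← pow_add, Nat.add_sub_cancel' hjk]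
  have a1 : (Nat.factorial k : ℝ) ≠ 0 := by positivity
  have a2 : (Nat.factorial j : ℝ) ≠ 0 := by positivity
  have a3 : (Nat.factorial (k - j) : ℝ) ≠ 0 := by positivity
  rw [e, neg_pow]
  field_simp

theorem truncation_error_finite_difference_expansion
    (p : ℕ → ℝ) (hp : ∀ n, 0 ≤ p n ∧ p n ≤ 1) (K : ℕ) (t : ℝ) (ht : 0 ≤ t) :
    |mp p t - ∑ k ∈ Finset.range (K + 1), fd p k * t ^ k / (Nat.factorial k : ℝ)|
      ≤ (2 * t) ^ (K + 1) / (Nat.factorial (K + 1) : ℝ) * Real.exp (2 * t) := by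
  have hb : ∀ k : ℕ, ‖fd p k * t ^ k / (Nat.factorial k : ℝ)‖
      ≤ (2 * t) ^ k / (Nat.factorial k : ℝ) := by
    intro k
    rw [norm_div, norm_mul, Real.norm_eq_abs, Real.norm_eq_abs, Real.norm_eq_abs,
      Nat.abs_cast, abs_of_nonneg (pow_nonneg ht k), mul_pow]
    have := fd_abs_le p hp k
    gcongr
  have hs : Summable fun k : ℕ => fd p k * t ^ k / (Nat.factorial k : ℝ) :=
    Summable.of_norm_bounded (hasSum_exp_div (2 * t)).summable hb
  rw [mp_eq_tsum p hp, ← hs.sum_add_tsum_nat_add (K + 1), add_sub_cancel_left,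
    ← Real.norm_eq_abs]
  refine tsum_of_norm_bounded
    ((hasSum_exp_div (2 * t)).mul_left ((2 * t) ^ (K + 1) / (Nat.factorial (K + 1) : ℝ)))
    fun k => (hb _).trans ?_
  rw [div_mul_div_comm, ← pow_add, add_comm k (K + 1)]
  have hf : ((Nat.factorial (K + 1) : ℝ) * (Nat.factorial k : ℝ))
      ≤ (Nat.factorial (K + 1 + k) : ℝ) := by
    exact_mod_cast Nat.le_of_dvd (Nat.factorial_pos _)
      (Nat.factorial_mul_factorial_dvd_factorial_add (K + 1) k)
  have h0 : (0 : ℝ) < (Nat.factorial (K + 1) : ℝ) * (Nat.factorial k : ℝ) := by positivity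
  exact div_le_div_of_nonneg_left (by positivity) h0 hf
end

section
/- There is an absolute constant C < ∞ such that for every retention rule p : ℕ → [0,1] with p(0) > 0 and every 0 < μ ≤ p(0)/4, one has m_p(μ) > 0 and |m_p(μ)^{−2} − p(0)^{−2}·(1 − 2μ·(p(1) − p(0))/p(0))| ≤ C·μ²/p(0)⁴. -/
open scoped BigOperators

lemma series_bound (p : ℕ → ℝ) (hp : ∀ n, 0 ≤ p n ∧ p n ≤ 1) (t : ℝ) (ht : 0 < t) :
    p 0 + p 1 * t ≤ ∑' n : ℕ, p n * t ^ n / (Nat.factorial n : ℝ) ∧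
    ∑' n : ℕ, p n * t ^ n / (Nat.factorial n : ℝ) ≤ p 0 + p 1 * t + (Real.exp t - 1 - t) := by
  have hs := Real.summable_pow_div_factorial t
  have hle : ∀ n, p n * t ^ n / (Nat.factorial n : ℝ) ≤ t ^ n / (Nat.factorial n : ℝ) := by
    intro n
    have : 0 ≤ t ^ n := by positivity
    gcongr
    nlinarith [(hp n).2]
  have h0 : ∀ n, 0 ≤ p n * t ^ n / (Nat.factorial n : ℝ) := by
    intro n
    have := (hp n).1
    positivity
  have hs' := Summable.of_nonneg_of_le h0 hle hs
  have e1 := hs.sum_add_tsum_nat_add 2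
  have e2 := hs'.sum_add_tsum_nat_add 2
  have he : Real.exp t = ∑' n : ℕ, t ^ n / (Nat.factorial n : ℝ) := by
    rw [Real.exp_eq_exp_ℝ, NormedSpace.exp_eq_tsum_div]
  rw [← he] at e1
  have hT0 : 0 ≤ ∑' n : ℕ, p (n+2) * t ^ (n+2) / (Nat.factorial (n+2) : ℝ) :=
    tsum_nonneg fun n => h0 (n+2)
  have hT1 : ∑' n : ℕ, p (n+2) * t ^ (n+2) / (Nat.factorial (n+2) : ℝ)
      ≤ ∑' n : ℕ, t ^ (n+2) / (Nat.factorial (n+2) : ℝ) :=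
    Summable.tsum_le_tsum (fun n => hle (n+2)) ((summable_nat_add_iff 2).2 hs')
      ((summable_nat_add_iff 2).2 hs)
  simp [Finset.sum_range_succ] at e1 e2
  constructor <;> linarith

lemma algebra_bound (a b t m : ℝ) (ha : 0 < a) (ha1 : a ≤ 1) (hb : 0 ≤ b) (hb1 : b ≤ 1)
    (ht : 0 < t) (hta : t ≤ a / 4) (hm : 3 / 4 * a ≤ m)
    (hR : |m - a - t * (b - a)| ≤ 3 * t ^ 2) :
    |(m ^ 2)⁻¹ - (a ^ 2)⁻¹ * (1 - 2 * t * (b - a) / a)| ≤ 30 * t ^ 2 / a ^ 4 := by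
  have hm0 : 0 < m := by linarith
  have hd : (m - a) ^ 2 ≤ 4 * t ^ 2 := by
    have := abs_le.1 hR
    have h1 : |m - a| ≤ 2 * t := by
      rw [abs_le]; constructor <;> nlinarith
    have h2 := abs_le.1 h1
    nlinarith
  have key : (m ^ 2)⁻¹ - (a ^ 2)⁻¹ * (1 - 2 * t * (b - a) / a)
      = (m - a) ^ 2 * (a / m * (a / m) + 2 * (a / m)) / a ^ 4
        + (-2 * a * (m - a - t * (b - a))) / a ^ 4 := by
    field_simp
    ring
  have hx : a / m ≤ 4 / 3 := by
    rw [div_le_iff₀ hm0]; linarith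
  have hx0 : 0 ≤ a / m := by positivity
  rw [key, ← add_div, abs_div, abs_of_pos (by positivity : 0 < a ^ 4)]
  gcongr
  have hy : a / m * (a / m) + 2 * (a / m) ≤ 5 := by nlinarith
  have hy0 : 0 ≤ a / m * (a / m) + 2 * (a / m) := by positivity
  have h1 : (m - a) ^ 2 * (a / m * (a / m) + 2 * (a / m)) ≤ 4 * t ^ 2 * 5 :=
    mul_le_mul hd hy hy0 (by positivity)
  have h10 : 0 ≤ (m - a) ^ 2 * (a / m * (a / m) + 2 * (a / m)) := by positivity
  have h2 : |-2 * a * (m - a - t * (b - a))| ≤ 2 * (3 * t ^ 2) := by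
    rw [abs_mul, abs_mul, abs_of_pos ha]
    norm_num
    nlinarith [abs_nonneg (m - a - t * (b - a))]
  have := abs_le.1 h2
  rw [abs_le]; constructor <;> nlinarith [sq_nonneg t]

theorem inverse_square_mp_expansion :
    ∃ C : ℝ, ∀ (p : ℕ → ℝ), (∀ n, 0 ≤ p n ∧ p n ≤ 1) → 0 < p 0 →
      ∀ μ : ℝ, 0 < μ → μ ≤ p 0 / 4 →
        0 < mp p μ ∧
        |((mp p μ) ^ 2)⁻¹ - ((p 0) ^ 2)⁻¹ * (1 - 2 * μ * (p 1 - p 0) / p 0)|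
          ≤ C * μ ^ 2 / (p 0) ^ 4 := by
  refine ⟨30, fun p hp h0 t ht hta => ?_⟩
  obtain ⟨hl, hu⟩ := series_bound p hp t ht
  obtain ⟨-, ha1⟩ := hp 0
  obtain ⟨hb, hb1⟩ := hp 1
  have ht4 : t ≤ 1 / 4 := by linarith
  have hE := Real.abs_exp_sub_one_sub_id_le (x := t) (by rw [abs_of_pos ht]; linarith)
  have hF := Real.abs_exp_sub_one_sub_id_le (x := -t) (by rw [abs_neg, abs_of_pos ht]; linarith)
  have hF0 := Real.add_one_le_exp (-t)
  have hF1 : Real.exp (-t) ≤ 1 := Real.exp_le_one_iff.2 (by linarith)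
  have hE2 := (abs_le.1 hE).2
  have hF2 := (abs_le.1 hF).2
  have hmd : mp p t = Real.exp (-t) * ∑' n : ℕ, p n * t ^ n / (Nat.factorial n : ℝ) := rfl
  generalize (∑' n : ℕ, p n * t ^ n / (Nat.factorial n : ℝ)) = S at *
  generalize Real.exp (-t) = e at *
  generalize mp p t = m at *
  generalize p 0 = a at *
  generalize p 1 = b at *
  have hbt : 0 ≤ b * t := by positivity
  have hbt1 : b * t ≤ 1 / 4 := by nlinarith
  have hm : 3 / 4 * a ≤ m := by
    rw [hmd]
    have : 3 / 4 * a ≤ e * a := by nlinarith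
    nlinarith
  refine ⟨by linarith, algebra_bound a b t m h0 ha1 hb hb1 ht hta hm ?_⟩
  obtain ⟨T, rfl⟩ : ∃ T, S = a + b * t + T := ⟨S - (a + b * t), by ring⟩
  obtain ⟨E, rfl⟩ : ∃ E, e = 1 - t + E := ⟨e - (1 - t), by ring⟩
  have hT0 : 0 ≤ T := by linarith
  have hT1 : T ≤ t ^ 2 := by linarith
  have hE0 : 0 ≤ E := by linarith
  have hE1 : E ≤ t ^ 2 := by nlinarith
  have hid : m - a - t * (b - a) = -(b * t ^ 2) + E * (a + b * t) + (1 - t + E) * T := by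
    rw [hmd]; ring
  have k1 : E * (a + b * t) ≤ t ^ 2 * (5 / 4) :=
    mul_le_mul hE1 (by linarith) (by linarith) (by positivity)
  have k2 : (1 - t + E) * T ≤ 1 * t ^ 2 := mul_le_mul hF1 hT1 hT0 (by norm_num)
  have k3 : 0 ≤ E * (a + b * t) := mul_nonneg hE0 (by linarith)
  have k4 : 0 ≤ (1 - t + E) * T := mul_nonneg (by linarith) hT0
  have k5 : b * t ^ 2 ≤ 1 * t ^ 2 := by gcongr
  have k6 : 0 ≤ b * t ^ 2 := by positivity
  rw [hid, abs_le]
  constructor <;> nlinarith [sq_nonneg t]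
end

section
/- Let p : ℕ → [0,1] satisfy p(0) > 0 and p(1) > 0. Then there is a finite constant C, depending only on p(0), such that for all ω ∈ [0,1], all I ∈ {0,1}, and all 0 < μ ≤ p(0)/4, the pair-correlation value admits the first-order contact-scale expansion |g_p(μ,ω,I) − (p(I)²/p(0)²)·{1 + μ·[ω·(1 − p(I+1)/p(I))² + 2·I·(p(I+1)/p(I) − p(1)/p(0))]}| ≤ C·μ², uniformly in ω and I. -/
open scoped BigOperators

/-- `Q_p(μ,ω,I) = E[p(U+V₁+I)p(U+V₂+I)]` for independent `U ~ Poisson(μω)`,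
`V₁,V₂ ~ Poisson(μ(1-ω))`, written as a triple series. -/
noncomputable def Qp (p : ℕ → ℝ) (μ ω : ℝ) (I : ℕ) : ℝ :=
  Real.exp (-(μ * (2 - ω))) *
    ∑' i : ℕ, ∑' j : ℕ, ∑' k : ℕ,
      p (i + k + I) * p (j + k + I) * (μ * (1 - ω)) ^ (i + j) * (μ * ω) ^ k /
        ((Nat.factorial i : ℝ) * (Nat.factorial j : ℝ) * (Nat.factorial k : ℝ))

/-- Pair-correlation value `g_p(μ,ω,I) = Q_p(μ,ω,I)/m_p(μ)²`. -/
noncomputable def gp (p : ℕ → ℝ) (μ ω : ℝ) (I : ℕ) : ℝ :=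
  Qp p μ ω I / (mp p μ) ^ 2

/-- Poisson expectation of `f`. -/
noncomputable def PE (t : ℝ) (f : ℕ → ℝ) : ℝ :=
  Real.exp (-t) * ∑' n : ℕ, f n * t ^ n / (Nat.factorial n : ℝ)

lemma PE_aux (t : ℝ) (ht : 0 ≤ t) (f : ℕ → ℝ) (hf : ∀ n, |f n| ≤ 1) (n : ℕ) :
    ‖f n * t ^ n / (Nat.factorial n : ℝ)‖ ≤ t ^ n / (Nat.factorial n : ℝ) := by
  have h0 : 0 ≤ t ^ n / (Nat.factorial n : ℝ) := by positivity
  rw [mul_div_assoc, Real.norm_eq_abs, abs_mul, abs_of_nonneg h0]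
  exact mul_le_of_le_one_left h0 (hf n)

lemma exp_hasSum (t : ℝ) : HasSum (fun n : ℕ => t ^ n / (Nat.factorial n : ℝ)) (Real.exp t) := by
  have := NormedSpace.expSeries_div_hasSum_exp (𝔸 := ℝ) t
  rwa [← Real.exp_eq_exp_ℝ] at this

lemma PE_le (t : ℝ) (ht : 0 ≤ t) (f : ℕ → ℝ) (hf : ∀ n, |f n| ≤ 1) : |PE t f| ≤ 1 := by
  have h := tsum_of_norm_bounded (exp_hasSum t) (PE_aux t ht f hf)
  rw [Real.norm_eq_abs] at h
  unfold PE
  rw [abs_mul, abs_of_pos (Real.exp_pos _)]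
  calc _ ≤ Real.exp (-t) * Real.exp t := by gcongr
    _ = 1 := by rw [← Real.exp_add]; simp

lemma PE_approx (t : ℝ) (ht : 0 ≤ t) (ht1 : t ≤ 1) (f : ℕ → ℝ) (hf : ∀ n, |f n| ≤ 1) :
    |PE t f - (f 0 + t * (f 1 - f 0))| ≤ 4 * t ^ 2 := by
  have hs : Summable (fun n => f n * t ^ n / (Nat.factorial n : ℝ)) :=
    Summable.of_norm_bounded (exp_hasSum t).summable (PE_aux t ht f hf)
  have h1 := hs.sum_add_tsum_nat_add 2
  have h2 := (exp_hasSum t).summable.sum_add_tsum_nat_add 2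
  rw [(exp_hasSum t).tsum_eq] at h2
  have h3 : ‖∑' n, f (n+2) * t ^ (n+2) / (Nat.factorial (n+2) : ℝ)‖ ≤
      ∑' n, t ^ (n+2) / (Nat.factorial (n+2) : ℝ) :=
    tsum_of_norm_bounded ((summable_nat_add_iff 2).2 (exp_hasSum t).summable).hasSum
      (fun n => PE_aux t ht f hf (n+2))
  simp only [Finset.sum_range_succ, Finset.sum_range_zero] at h1 h2
  norm_num at h1 h2
  rw [Real.norm_eq_abs] at h3
  unfold PE
  rw [← h1]
  set r := ∑' n, f (n+2) * t ^ (n+2) / (Nat.factorial (n+2) : ℝ)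
  have e1 := Real.abs_exp_sub_one_sub_id_le (x := t) (by rwa [abs_of_nonneg ht])
  have e2 := Real.abs_exp_sub_one_sub_id_le (x := -t) (by rwa [abs_neg, abs_of_nonneg ht])
  have hr : |r| ≤ t ^ 2 := by
    have := (abs_le.1 e1).2
    linarith
  have e3 : Real.exp (-t) ≤ 1 := by simpa using ht
  have e4 := Real.exp_pos (-t)
  generalize Real.exp (-t) = x at *
  have key : x * (f 0 + f 1 * t + r) - (f 0 + t * (f 1 - f 0)) =
    -(f 1 * t ^ 2) + (x - 1 - -t) * (f 0 + f 1 * t) + x * r := by ring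
  have a1 : |f 1 * t ^ 2| ≤ t ^ 2 := by
    rw [abs_mul, abs_of_nonneg (sq_nonneg t)]
    exact mul_le_of_le_one_left (sq_nonneg t) (hf 1)
  have a3 : |f 0 + f 1 * t| ≤ 2 := by
    have : |f 1 * t| ≤ 1 := by
      rw [abs_mul, abs_of_nonneg ht]; exact mul_le_one₀ (hf 1) ht ht1
    linarith [abs_add_le (f 0) (f 1 * t), hf 0]
  have a2 : |(x - 1 - -t) * (f 0 + f 1 * t)| ≤ t ^ 2 * 2 := by
    rw [abs_mul]; rw [neg_sq] at e2; gcongr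
  have a4 : |x * r| ≤ t ^ 2 := by
    rw [abs_mul, abs_of_pos e4]
    calc x * |r| ≤ 1 * t ^ 2 := by gcongr
      _ = _ := one_mul _
  rw [key]
  rw [abs_le] at *
  constructor <;> linarith [a1.1, a1.2, a2.1, a2.2, a4.1, a4.2]

lemma Qp_eq (p : ℕ → ℝ) (μ ω : ℝ) (I : ℕ) : Qp p μ ω I =
    PE (μ * (1 - ω)) (fun i => PE (μ * (1 - ω)) (fun j => PE (μ * ω)
      (fun k => p (i + k + I) * p (j + k + I)))) := by
  unfold Qp PE
  have : Real.exp (-(μ * (2 - ω))) = Real.exp (-(μ * (1 - ω))) *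
      (Real.exp (-(μ * (1 - ω))) * Real.exp (-(μ * ω))) := by
    rw [← Real.exp_add, ← Real.exp_add]; congr 1; ring
  rw [this]
  simp only [← tsum_mul_left, ← tsum_mul_right, ← tsum_div_const]
  refine tsum_congr fun i => tsum_congr fun j => tsum_congr fun k => ?_
  rw [pow_add]
  field_simp

lemma abs_mul_bd {x y A B : ℝ} (hx : |x| ≤ A) (hy : |y| ≤ B) : |x * y| ≤ A * B := by
  rw [abs_mul]
  exact mul_le_mul hx hy (abs_nonneg _) ((abs_nonneg _).trans hx)

lemma Qp_approx (p : ℕ → ℝ) (hp : ∀ n, 0 ≤ p n ∧ p n ≤ 1) (μ ω : ℝ) (h0 : 0 ≤ ω) (h1 : ω ≤ 1)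
    (hμ : 0 ≤ μ) (hμ1 : μ ≤ 1) (I : ℕ) :
    |Qp p μ ω I - (p I ^ 2 + μ * (ω * (p I - p (I+1)) ^ 2 + 2 * p I * (p (I+1) - p I)))|
      ≤ 40 * μ ^ 2 := by
  rw [Qp_eq]
  have ha0 : 0 ≤ μ * (1 - ω) := mul_nonneg hμ (by linarith)
  have hb0 : 0 ≤ μ * ω := mul_nonneg hμ h0
  have ha : μ * (1 - ω) ≤ μ := by nlinarith
  have hb : μ * ω ≤ μ := by nlinarith
  have ht : p I ^ 2 + μ * (ω * (p I - p (I+1)) ^ 2 + 2 * p I * (p (I+1) - p I)) =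
    p I * p I + (μ * ω) * (p (I+1) * p (I+1) - p I * p I)
      + (μ * (1-ω)) * (p I * p (I+1) + p (I+1) * p I - 2 * (p I * p I)) := by ring
  rw [ht]
  generalize μ * (1 - ω) = a at *
  generalize μ * ω = b at *
  have hF : ∀ i j : ℕ, 0 ≤ p i * p j ∧ p i * p j ≤ 1 := fun i j =>
    ⟨mul_nonneg (hp i).1 (hp j).1, mul_le_one₀ (hp i).2 (hp j).1 (hp j).2⟩
  have hF' : ∀ i j : ℕ, |p i * p j| ≤ 1 := fun i j => by
    rw [abs_of_nonneg (hF i j).1]; exact (hF i j).2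
  set G : ℕ → ℕ → ℝ := fun i j => PE b (fun k => p (i + k + I) * p (j + k + I)) with hG
  have hG1 : ∀ i j, |G i j| ≤ 1 := fun i j => PE_le b hb0 _ (fun k => hF' _ _)
  have hGa : ∀ i j, |G i j - (p (i + 0 + I) * p (j + 0 + I) +
      b * (p (i + 1 + I) * p (j + 1 + I) - p (i + 0 + I) * p (j + 0 + I)))| ≤ 4 * b ^ 2 :=
    fun i j => PE_approx b hb0 (by linarith) _ (fun k => hF' _ _)
  have hGc : ∀ i j, |G i j - p (i + 0 + I) * p (j + 0 + I)| ≤ 5 * μ := fun i j => by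
    have h := hGa i j
    have h2 : |b * (p (i + 1 + I) * p (j + 1 + I) - p (i + 0 + I) * p (j + 0 + I))| ≤ b * 1 := by
      apply abs_mul_bd (by rw [abs_of_nonneg hb0])
      rw [abs_le]; constructor <;>
        linarith [(hF (i+1+I) (j+1+I)).1, (hF (i+1+I) (j+1+I)).2, (hF (i+0+I) (j+0+I)).1,
          (hF (i+0+I) (j+0+I)).2]
    have h3 : b ^ 2 ≤ μ := by nlinarith
    rw [abs_le] at *
    constructor <;> linarith [h.1, h.2, h2.1, h2.2]
  set H : ℕ → ℝ := fun i => PE a (G i) with hH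
  have hHa : ∀ i, |H i - (G i 0 + a * (G i 1 - G i 0))| ≤ 4 * a ^ 2 :=
    fun i => PE_approx a ha0 (by linarith) _ (hG1 i)
  have hQ : |PE a H - (H 0 + a * (H 1 - H 0))| ≤ 4 * a ^ 2 :=
    PE_approx a ha0 (by linarith) _ (fun i => PE_le a ha0 _ (hG1 i))
  have ha2 : a ^ 2 ≤ μ ^ 2 := by gcongr
  have hb2 : b ^ 2 ≤ μ ^ 2 := by gcongr
  have haa : |a| ≤ μ := by rwa [abs_of_nonneg ha0]
  have haa1 : |a| ≤ 1 := haa.trans hμ1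
  have g00 := hGa 0 0
  have c00 := abs_mul_bd haa (hGc 0 0)
  have c01 := abs_mul_bd haa (hGc 0 1)
  have c10 := abs_mul_bd haa (hGc 1 0)
  have k0 := abs_mul_bd (show |1 - a| ≤ 1 by rw [abs_le]; constructor <;> linarith) (hHa 0)
  have k1 := abs_mul_bd haa1 (hHa 1)
  have k2 := abs_mul_bd (show |a ^ 2| ≤ μ ^ 2 by rwa [abs_of_nonneg (sq_nonneg a)])
    (show |G 1 1 - G 1 0 - G 0 1 + G 0 0| ≤ 4 by
      have u1 := abs_le.1 (hG1 0 0)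
      have u2 := abs_le.1 (hG1 0 1)
      have u3 := abs_le.1 (hG1 1 0)
      have u4 := abs_le.1 (hG1 1 1)
      rw [abs_le]; constructor <;> linarith [u1.1, u1.2, u2.1, u2.2, u3.1, u3.2, u4.1, u4.2])
  simp only [zero_add, add_zero, add_comm 1 I] at g00 c00 c01 c10
  change |PE a H - _| ≤ _
  clear_value G H
  generalize PE a H = Q at *
  have key : Q - (p I * p I + b * (p (I+1) * p (I+1) - p I * p I)
      + a * (p I * p (I+1) + p (I+1) * p I - 2 * (p I * p I))) =
    (Q - (H 0 + a * (H 1 - H 0))) + (1 - a) * (H 0 - (G 0 0 + a * (G 0 1 - G 0 0)))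
    + a * (H 1 - (G 1 0 + a * (G 1 1 - G 1 0))) + a ^ 2 * (G 1 1 - G 1 0 - G 0 1 + G 0 0)
    + (G 0 0 - (p I * p I + b * (p (I+1) * p (I+1) - p I * p I)))
    + a * (G 0 1 - p I * p (I+1)) + a * (G 1 0 - p (I+1) * p I)
    - 2 * (a * (G 0 0 - p I * p I)) := by ring
  rw [key]
  rw [abs_le] at hQ k0 k1 k2 g00 c00 c01 c10 ⊢
  constructor
  · linarith [hQ.1, k0.1, k1.1, k2.1, g00.1, c01.1, c10.1, c00.2]
  · linarith [hQ.2, k0.2, k1.2, k2.2, g00.2, c01.2, c10.2, c00.1]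

lemma ratio_bound (P q c d m Q μ : ℝ) (hP : 0 < P) (hP1 : P ≤ 1) (hq : |q| ≤ 1) (hc : |c| ≤ 3)
    (hd : |d| ≤ 1) (hμ : 0 < μ) (hμ1 : μ ≤ 1 / 4) (hm : |m - (P + μ * d)| ≤ 4 * μ ^ 2)
    (hQ : |Q - (q + μ * c)| ≤ 40 * μ ^ 2) (hm0 : P * (3 / 4) ≤ m) :
    |Q / m ^ 2 - (q / P ^ 2 + μ * (c / P ^ 2 - 2 * q * d / P ^ 3))| ≤ 200 / P ^ 5 * μ ^ 2 := by
  have hμ2 : 0 < μ ^ 2 := by positivity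
  obtain ⟨m2, rfl⟩ : ∃ m2, m = P + μ * d + μ ^ 2 * m2 :=
    ⟨(m - (P + μ * d)) / μ ^ 2, by field_simp; ring⟩
  obtain ⟨Q2, rfl⟩ : ∃ Q2, Q = q + μ * c + μ ^ 2 * Q2 :=
    ⟨(Q - (q + μ * c)) / μ ^ 2, by field_simp; ring⟩
  rw [add_sub_cancel_left, abs_mul, abs_of_pos hμ2] at hm hQ
  have hm2 : |m2| ≤ 4 := by nlinarith
  have hQ2 : |Q2| ≤ 40 := by nlinarith
  have hPa : |P| ≤ 1 := by rwa [abs_of_pos hP]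
  have hμa : |μ| ≤ 1 / 4 := by rwa [abs_of_pos hμ]
  have hn : |d + μ * m2| ≤ 2 := by
    linarith [abs_add_le d (μ * m2), abs_mul_bd hμa hm2]
  have hR : |P ^ 3 * Q2 - (q * P) * (2 * P * m2 + (d + μ * m2) ^ 2)
      - (c * P - 2 * q * d) * (2 * P * (d + μ * m2) + μ * (d + μ * m2) ^ 2)| ≤ 100 := by
    generalize d + μ * m2 = n at *
    have hP3 : |P ^ 3| ≤ 1 := by rw [abs_of_pos (by positivity)]; exact pow_le_one₀ hP.le hP1
    have hn2 : |n ^ 2| ≤ 4 := by rw [pow_two]; linarith [abs_mul_bd hn hn]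
    have r1 := abs_mul_bd hP3 hQ2
    have r2 : |2 * P * m2 + n ^ 2| ≤ 12 := by
      have h := abs_le.1 (abs_mul_bd hPa hm2)
      have h' := abs_le.1 hn2
      rw [abs_le]; constructor <;> linarith [h.1, h.2, h'.1, h'.2]
    have r3 := abs_mul_bd (abs_mul_bd hq hPa) r2
    have r4 : |c * P - 2 * q * d| ≤ 5 := by
      have h := abs_le.1 (abs_mul_bd hc hPa)
      have h' := abs_le.1 (abs_mul_bd hq hd)
      rw [abs_le]; constructor <;> linarith [h.1, h.2, h'.1, h'.2]
    have r5 : |2 * P * n + μ * n ^ 2| ≤ 5 := by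
      have h := abs_le.1 (abs_mul_bd hPa hn)
      have h' := abs_le.1 (abs_mul_bd hμa hn2)
      rw [abs_le]; constructor <;> linarith [h.1, h.2, h'.1, h'.2]
    have r6 := abs_mul_bd r4 r5
    rw [abs_le] at r1 r3 r6 ⊢
    constructor <;> linarith [r1.1, r1.2, r3.1, r3.2, r6.1, r6.2]
  have key : (q + μ * c + μ ^ 2 * Q2) / (P + μ * d + μ ^ 2 * m2) ^ 2
      - (q / P ^ 2 + μ * (c / P ^ 2 - 2 * q * d / P ^ 3)) =
    μ ^ 2 * (P ^ 3 * Q2 - (q * P) * (2 * P * m2 + (d + μ * m2) ^ 2)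
      - (c * P - 2 * q * d) * (2 * P * (d + μ * m2) + μ * (d + μ * m2) ^ 2)) /
      (P ^ 3 * (P + μ * d + μ ^ 2 * m2) ^ 2) := by
    have : P + μ * d + μ ^ 2 * m2 ≠ 0 := by
      have : 0 < P * (3/4) := by positivity
      linarith
    field_simp
    ring
  rw [key]
  generalize P + μ * d + μ ^ 2 * m2 = m at *
  have hmsq : P ^ 2 / 2 ≤ m ^ 2 := by nlinarith
  rw [abs_div, abs_mul, abs_of_pos hμ2, abs_of_nonneg (show 0 ≤ P ^ 3 * m ^ 2 by positivity)]
  calc _ ≤ μ ^ 2 * 100 / (P ^ 3 * (P ^ 2 / 2)) := by gcongr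
    _ = _ := by field_simp; ring

theorem first_order_contact_scale_expansion_of_g :
    ∀ p0 : ℝ, 0 < p0 →
      ∃ C : ℝ, ∀ (p : ℕ → ℝ), (∀ n, 0 ≤ p n ∧ p n ≤ 1) → p 0 = p0 → 0 < p 1 →
        ∀ ω : ℝ, 0 ≤ ω → ω ≤ 1 → ∀ I : ℕ, I ≤ 1 →
          ∀ μ : ℝ, 0 < μ → μ ≤ p 0 / 4 →
            |gp p μ ω I
                - (p I) ^ 2 / (p 0) ^ 2 *
                  (1 + μ * (ω * (1 - p (I + 1) / p I) ^ 2
                    + 2 * (I : ℝ) * (p (I + 1) / p I - p 1 / p 0)))|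
              ≤ C * μ ^ 2 := by
  intro p0 hp0
  refine ⟨200 / p0 ^ 5, ?_⟩
  intro p hp hpp hp1 ω h0 h1 I hI μ hμ hμ1
  subst hpp
  have hμ4 : μ ≤ 1 / 4 := by linarith [(hp 0).2]
  have hpa : ∀ n, |p n| ≤ 1 := fun n => by rw [abs_of_nonneg (hp n).1]; exact (hp n).2
  have hdd : ∀ m n, |p m - p n| ≤ 1 := fun m n => by
    rw [abs_le]; constructor <;> linarith [(hp m).1, (hp m).2, (hp n).1, (hp n).2]
  have hm : |mp p μ - (p 0 + μ * (p 1 - p 0))| ≤ 4 * μ ^ 2 :=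
    PE_approx μ hμ.le (by linarith) p hpa
  have hQ := Qp_approx p hp μ ω h0 h1 hμ.le (by linarith) I
  have hm0 : p 0 * (3 / 4) ≤ mp p μ := by
    have hs : Summable (fun n => p n * μ ^ n / (Nat.factorial n : ℝ)) :=
      Summable.of_norm_bounded (exp_hasSum μ).summable (PE_aux μ hμ.le p hpa)
    have h := hs.le_tsum 0 (fun n _ => by have := (hp n).1; positivity)
    norm_num at h
    have he : 3 / 4 ≤ Real.exp (-μ) := by linarith [Real.add_one_le_exp (-μ)]
    unfold mp
    calc p 0 * (3 / 4) = 3 / 4 * p 0 := by ring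
      _ ≤ _ := by gcongr
  have hc : |ω * (p I - p (I+1)) ^ 2 + 2 * p I * (p (I+1) - p I)| ≤ 3 := by
    have u1 := abs_mul_bd (show |ω| ≤ 1 by rwa [abs_of_nonneg h0])
      (abs_mul_bd (hdd I (I+1)) (hdd I (I+1)))
    have u2 := abs_mul_bd (hpa I) (hdd (I+1) I)
    rw [abs_le] at u1 u2 ⊢
    constructor <;> nlinarith [u1.1, u1.2, u2.1, u2.2]
  have hq : |p I ^ 2| ≤ 1 := by
    rw [pow_two]; linarith [abs_mul_bd (hpa I) (hpa I)]
  have := ratio_bound (p 0) (p I ^ 2) _ (p 1 - p 0) (mp p μ) (Qp p μ ω I) μ hp0 (hp 0).2 hq hc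
    (hdd 1 0) hμ hμ4 hm hQ hm0
  unfold gp
  convert this using 3
  have hne : p I ≠ 0 := by
    interval_cases I
    · exact hp0.ne'
    · exact hp1.ne'
  interval_cases I
  · field_simp
    push_cast
    ring
  · field_simp
    push_cast
    ring
end

section
/- Let p : ℕ → [0,1] satisfy p(0) = 0 and c := p(1) > 0. Then there exist constants μ₀ > 0 and C < ∞, depending only on c, such that for all 0 < μ ≤ μ₀ and all ω ∈ [0,1], one has m_p(μ) > 0 and |g_p(μ, ω, 0) − ω/μ| ≤ C. (This is the ring regime 1 < ‖h‖/r ≤ 2, where ω = ω_d(‖h‖/r).) -/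
open scoped BigOperators

lemma aux_S (p : ℕ → ℝ) (hp : ∀ n, 0 ≤ p n ∧ p n ≤ 1) (h0 : p 0 = 0) (μ : ℝ) (hμ : 0 < μ)
    (hμ1 : μ ≤ 1) :
    p 1 * μ ≤ ∑' n : ℕ, p n * μ ^ n / (Nat.factorial n : ℝ) ∧
    ∑' n : ℕ, p n * μ ^ n / (Nat.factorial n : ℝ) ≤ p 1 * μ + μ ^ 2 := by
  have hE : HasSum (fun n : ℕ => μ ^ n / (Nat.factorial n : ℝ)) (Real.exp μ) := by
    rw [Real.exp_eq_exp_ℝ]; exact NormedSpace.expSeries_div_hasSum_exp μ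
  have hnn : ∀ n : ℕ, 0 ≤ p n * μ ^ n / (Nat.factorial n : ℝ) := fun n => by
    have := (hp n).1; positivity
  have hle : ∀ n : ℕ, p n * μ ^ n / (Nat.factorial n : ℝ) ≤ μ ^ n / (Nat.factorial n : ℝ) := by
    intro n
    have : p n * μ ^ n ≤ μ ^ n := by
      have := (hp n).2
      have h2 : 0 ≤ μ ^ n := by positivity
      nlinarith
    gcongr
  have hs : Summable (fun n : ℕ => p n * μ ^ n / (Nat.factorial n : ℝ)) :=
    Summable.of_nonneg_of_le hnn hle hE.summable
  constructor
  · have := hs.le_tsum 1 (fun n _ => hnn n)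
    simpa using this
  · have hH := (hE.sub (hasSum_ite_eq (0 : ℕ) (1 : ℝ))).sub
      (hasSum_ite_eq (1 : ℕ) ((1 - p 1) * μ))
    have h1 := hasSum_le (fun n => ?_) hs.hasSum hH
    · have h2 := Real.abs_exp_sub_one_sub_id_le (x := μ) (by rw [abs_of_pos hμ]; exact hμ1)
      have h3 := (abs_le.1 h2).2
      linarith
    · rcases n with _ | _ | n
      · simp [h0]
      · simp; linarith
      · simpa using hle (n + 2)

lemma aux_T (p : ℕ → ℝ) (hp : ∀ n, 0 ≤ p n ∧ p n ≤ 1) (h0 : p 0 = 0) (a b : ℝ) (ha : 0 ≤ a)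
    (hb : 0 ≤ b) (hab : a + a + b ≤ 1) (T : ℝ)
    (hT : T = ∑' i : ℕ, ∑' j : ℕ, ∑' k : ℕ,
      p (i + k + 0) * p (j + k + 0) * a ^ (i + j) * b ^ k /
        ((Nat.factorial i : ℝ) * (Nat.factorial j : ℝ) * (Nat.factorial k : ℝ))) :
    p 1 ^ 2 * b ≤ T ∧ T ≤ p 1 ^ 2 * b + (a + a + b) ^ 2 := by
  have hE : ∀ x : ℝ, HasSum (fun n : ℕ => x ^ n / (Nat.factorial n : ℝ)) (Real.exp x) := by
    intro x
    rw [Real.exp_eq_exp_ℝ]; exact NormedSpace.expSeries_div_hasSum_exp x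
  have hn : ∀ x : ℝ, 0 ≤ x → 0 ≤ (fun n : ℕ => x ^ n / (Nat.factorial n : ℝ)) := by
    intro x hx n
    simp only [Pi.zero_apply]
    positivity
  set F : ℕ × ℕ × ℕ → ℝ := fun q => a ^ q.1 / (Nat.factorial q.1 : ℝ) *
    (a ^ q.2.1 / (Nat.factorial q.2.1 : ℝ) * (b ^ q.2.2 / (Nat.factorial q.2.2 : ℝ))) with hF
  set G : ℕ × ℕ × ℕ → ℝ := fun q => p (q.1 + q.2.2 + 0) * p (q.2.1 + q.2.2 + 0) *
    a ^ (q.1 + q.2.1) * b ^ q.2.2 /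
    ((Nat.factorial q.1 : ℝ) * (Nat.factorial q.2.1 : ℝ) * (Nat.factorial q.2.2 : ℝ)) with hG
  have s1 := (hE a).summable.mul_of_nonneg (hE b).summable (hn a ha) (hn b hb)
  have e1 := (hE a).mul (hE b) s1
  have s2 := (hE a).summable.mul_of_nonneg s1 (hn a ha)
    (fun q => mul_nonneg (hn a ha q.1) (hn b hb q.2))
  have e2 : HasSum F (Real.exp a * (Real.exp a * Real.exp b)) := (hE a).mul e1 s2
  have hGF : ∀ q, G q = p (q.1 + q.2.2) * p (q.2.1 + q.2.2) * F q := by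
    intro q
    simp only [hG, hF, add_zero, pow_add]
    field_simp
  have hF0 : ∀ q, 0 ≤ F q := fun q => by simp only [hF]; positivity
  have hG0 : ∀ q, 0 ≤ G q := fun q => by
    rw [hGF]
    exact mul_nonneg (mul_nonneg (hp _).1 (hp _).1) (hF0 q)
  have hle : ∀ q, G q ≤ F q := fun q => by
    rw [hGF]
    exact mul_le_of_le_one_left (hF0 q) (mul_le_one₀ (hp _).2 (hp _).1 (hp _).2)
  have hs : Summable G := Summable.of_nonneg_of_le hG0 hle e2.summable
  have hTG : T = ∑' q, G q := by
    rw [hT, hs.tsum_prod]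
    refine tsum_congr fun i => ?_
    rw [(hs.prod_factor i).tsum_prod]
  rw [hTG]
  constructor
  · have := hs.le_tsum (0, 0, 1) (fun n _ => hG0 n)
    refine le_trans (le_of_eq ?_) this
    simp [hG, sq]
  · have hH := (((e2.sub (hasSum_ite_eq ((0, 0, 0) : ℕ × ℕ × ℕ) (1 : ℝ))).sub
      (hasSum_ite_eq ((1, 0, 0) : ℕ × ℕ × ℕ) a)).sub
      (hasSum_ite_eq ((0, 1, 0) : ℕ × ℕ × ℕ) a)).sub
      (hasSum_ite_eq ((0, 0, 1) : ℕ × ℕ × ℕ) ((1 - p 1 ^ 2) * b))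
    have h1 := hasSum_le (fun q => ?_) hs.hasSum hH
    · have h2 := Real.abs_exp_sub_one_sub_id_le (x := a + a + b)
        (by rw [abs_of_nonneg (by positivity)]; exact hab)
      have h3 := (abs_le.1 h2).2
      rw [Real.exp_add, Real.exp_add] at h3
      linarith
    · by_cases q0 : q = (0, 0, 0)
      · subst q0; simp [hGF, hF, h0]
      by_cases q1 : q = (1, 0, 0)
      · subst q1; simp [hGF, hF, h0]
      by_cases q2 : q = (0, 1, 0)
      · subst q2; simp [hGF, hF, h0]
      by_cases q3 : q = (0, 0, 1)
      · subst q3; simp [hGF, hF]; linarith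
      simpa [q0, q1, q2, q3] using hle q

theorem ring_regime_asymptotics_p0_zero :
    ∀ c : ℝ, 0 < c →
      ∃ μ₀ : ℝ, 0 < μ₀ ∧ ∃ C : ℝ,
        ∀ (p : ℕ → ℝ), (∀ n, 0 ≤ p n ∧ p n ≤ 1) → p 0 = 0 → p 1 = c →
          ∀ μ : ℝ, 0 < μ → μ ≤ μ₀ → ∀ ω : ℝ, 0 ≤ ω → ω ≤ 1 →
            0 < mp p μ ∧ |gp p μ ω 0 - ω / μ| ≤ C := by
  intro c hc
  refine ⟨1 / 2, by norm_num, 2 + 8 / c ^ 2 + 2 / c, ?_⟩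
  intro p hp h0 h1 μ hμ hμ2 ω hω0 hω1
  obtain ⟨hS1, hS2⟩ := aux_S p hp h0 μ hμ (by linarith)
  have hb : 0 ≤ μ * ω := by positivity
  have ha : 0 ≤ μ * (1 - ω) := mul_nonneg hμ.le (by linarith)
  obtain ⟨hT1, hT2⟩ := aux_T p hp h0 (μ * (1 - ω)) (μ * ω) ha hb (by nlinarith) _ rfl
  have hT3 : (μ * (1 - ω) + μ * (1 - ω) + μ * ω) ^ 2 ≤ 4 * μ ^ 2 := by
    have : μ * (1 - ω) + μ * (1 - ω) + μ * ω ≤ 2 * μ := by nlinarith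
    calc _ ≤ (2 * μ) ^ 2 := by gcongr
      _ = _ := by ring
  unfold gp mp Qp
  rw [h1] at hS1 hS2 hT1 hT2
  generalize (∑' n : ℕ, p n * μ ^ n / (Nat.factorial n : ℝ)) = S at *
  generalize (∑' i : ℕ, ∑' j : ℕ, ∑' k : ℕ,
      p (i + k + 0) * p (j + k + 0) * (μ * (1 - ω)) ^ (i + j) * (μ * ω) ^ k /
        ((Nat.factorial i : ℝ) * (Nat.factorial j : ℝ) * (Nat.factorial k : ℝ))) = T at *
  have hcμ : 0 < c * μ := by positivity
  have hS : 0 < S := by linarith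
  refine ⟨by positivity, ?_⟩
  have hg : Real.exp (-(μ * (2 - ω))) * T / (Real.exp (-μ) * S) ^ 2
      = Real.exp (μ * ω) * T / S ^ 2 := by
    have : Real.exp (-(μ * (2 - ω))) = Real.exp (μ * ω) * Real.exp (-μ) ^ 2 := by
      rw [← Real.exp_nat_mul, ← Real.exp_add]
      congr 1
      push_cast
      ring
    rw [this]
    have := Real.exp_pos (-μ)
    field_simp
  rw [hg]
  have hbμ : μ * ω ≤ μ := by nlinarith
  have hx1 : 1 ≤ Real.exp (μ * ω) := Real.one_le_exp hb
  have hx2 : Real.exp (μ * ω) ≤ 1 + 2 * μ := by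
    have h2 := Real.abs_exp_sub_one_sub_id_le (x := μ * ω)
        (by rw [abs_of_nonneg hb]; linarith)
    have h3 := (abs_le.1 h2).2
    nlinarith
  have hT0 : 0 ≤ T := le_trans (by positivity) hT1
  have hc8 : 0 < 8 / c ^ 2 := by positivity
  have hc2 : 0 < 2 / c := by positivity
  rw [abs_le]
  constructor
  · have l1 : c ^ 2 * (μ * ω) / (c * μ + μ ^ 2) ^ 2 ≤ Real.exp (μ * ω) * T / S ^ 2 := by
      have : c ^ 2 * (μ * ω) ≤ Real.exp (μ * ω) * T := by nlinarith
      gcongr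
    have l2 : ω / μ - 2 / c ≤ c ^ 2 * (μ * ω) / (c * μ + μ ^ 2) ^ 2 := by
      have e : c ^ 2 * (μ * ω) / (c * μ + μ ^ 2) ^ 2 - (ω / μ - 2 / c)
          = (2 * (c + μ) ^ 2 - ω * (2 * c ^ 2 + c * μ)) / (c * (c + μ) ^ 2) := by
        field_simp
        ring
      have : 0 ≤ (2 * (c + μ) ^ 2 - ω * (2 * c ^ 2 + c * μ)) / (c * (c + μ) ^ 2) := by
        apply div_nonneg _ (by positivity)
        have : ω * (2 * c ^ 2 + c * μ) ≤ 1 * (2 * c ^ 2 + c * μ) := by gcongr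
        nlinarith [sq_nonneg μ, mul_pos hc hμ]
      linarith
    linarith
  · have u1 : Real.exp (μ * ω) * T / S ^ 2
        ≤ (1 + 2 * μ) * (c ^ 2 * (μ * ω) + 4 * μ ^ 2) / (c * μ) ^ 2 := by
      have : T ≤ c ^ 2 * (μ * ω) + 4 * μ ^ 2 := by linarith
      gcongr
    have u2 : (1 + 2 * μ) * (c ^ 2 * (μ * ω) + 4 * μ ^ 2) / (c * μ) ^ 2
        = ω / μ + 2 * ω + (1 + 2 * μ) * 4 / c ^ 2 := by
      field_simp
    have u3 : (1 + 2 * μ) * 4 / c ^ 2 ≤ 8 / c ^ 2 := by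
      gcongr
      linarith
    linarith
end

section
/- Let p : ℕ → [0,1] satisfy p(0) = 0 and c := p(1) > 0, and set s := p(2)/p(1). Then there exist constants μ₀ > 0 and C < ∞, depending only on c, such that for all 0 < μ ≤ μ₀ and all ω ∈ [0,1], one has m_p(μ) > 0 and |g_p(μ, ω, 1) − μ^{−2}·(1 + μ·(s + ω·(1 − s)²))| ≤ C. (This is the contact regime 0 < ‖h‖/r ≤ 1, where ω = ω_d(‖h‖/r).) -/
open scoped BigOperators

lemma tail_bound {α : Type} (f B : α → ℝ) (s : Finset α) (ε : ℝ) (hε : 0 ≤ ε)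
    (hf : ∀ x, 0 ≤ f x) (hfs : Summable f) (hB : Summable B) (hB0 : ∀ x, 0 ≤ B x)
    (h : ∀ x, x ∉ s → f x ≤ ε * B x) :
    0 ≤ ∑' x, f x - ∑ x ∈ s, f x ∧ ∑' x, f x - ∑ x ∈ s, f x ≤ ε * ∑' x, B x := by
  refine ⟨sub_nonneg.2 (hfs.sum_le_tsum s (fun x _ => hf x)), ?_⟩
  have h1 := hfs.sum_add_tsum_compl (s := s)
  have h2 : ∑' x : ((s : Set α)ᶜ : Set α), f x ≤ ∑' x : ((s : Set α)ᶜ : Set α), ε * B x := by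
    refine Summable.tsum_le_tsum (fun x => h x.1 (fun hx => x.2 (Finset.mem_coe.2 hx))) (hfs.subtype _)
      ((hB.mul_left ε).subtype _)
  have h3 : ∑' x : ((s : Set α)ᶜ : Set α), ε * B x ≤ ∑' x, ε * B x :=
    (hB.mul_left ε).tsum_subtype_le _ _ (fun x => mul_nonneg hε (hB0 x))
  have h4 : ∑' x, ε * B x = ε * ∑' x, B x := tsum_mul_left
  linarith

lemma inv_fact_summable : Summable (fun n : ℕ => 1 / (Nat.factorial n : ℝ)) := by
  simpa using Real.summable_pow_div_factorial 1

lemma m_expand (p : ℕ → ℝ) (hp : ∀ n, 0 ≤ p n ∧ p n ≤ 1) (h0 : p 0 = 0) (μ : ℝ) (hμ : 0 < μ)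
    (hμ1 : μ ≤ 1) (K : ℝ) (hK : K = ∑' n : ℕ, 1 / (Nat.factorial n : ℝ)) :
    ∃ r : ℝ, 0 ≤ r ∧ r ≤ K ∧
      mp p μ = Real.exp (-μ) * (μ * (p 1 + μ * (p 2 / 2) + μ ^ 2 * r)) := by
  have hf : ∀ n, 0 ≤ p n * μ ^ n / (Nat.factorial n : ℝ) := fun n => by
    have := (hp n).1
    positivity
  have hb : ∀ n, 3 ≤ n → p n * μ ^ n / (Nat.factorial n : ℝ) ≤ μ ^ 3 * (1 / (Nat.factorial n : ℝ)) := by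
    intro n hn
    rw [mul_one_div]
    have : p n * μ ^ n ≤ 1 * μ ^ 3 :=
      mul_le_mul (hp n).2 (pow_le_pow_of_le_one hμ.le hμ1 hn) (by positivity) zero_le_one
    gcongr
    linarith
  have hfs : Summable (fun n : ℕ => p n * μ ^ n / (Nat.factorial n : ℝ)) := by
    refine Summable.of_nonneg_of_le hf (fun n => ?_) (Real.summable_pow_div_factorial μ)
    gcongr
    have := (hp n).2
    have h2 : 0 ≤ μ ^ n := by positivity
    nlinarith
  obtain ⟨a, b⟩ := tail_bound _ _ (Finset.range 3) (μ ^ 3) (by positivity) hf hfs inv_fact_summable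
    (fun n => by positivity) (fun n hn => hb n (by simpa using hn))
  rw [← hK] at b
  set D := ∑' n : ℕ, p n * μ ^ n / (Nat.factorial n : ℝ) - ∑ n ∈ Finset.range 3, p n * μ ^ n / (Nat.factorial n : ℝ) with hD
  refine ⟨D / μ ^ 3, by positivity, by rw [div_le_iff₀ (by positivity)]; linarith, ?_⟩
  have : ∑' n : ℕ, p n * μ ^ n / (Nat.factorial n : ℝ) = D + (p 1 * μ + p 2 * μ ^ 2 / 2) := by
    rw [hD]; simp [Finset.sum_range_succ, h0]
  rw [mp, this]
  congr 1
  field_simp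
  ring

lemma Q_expand (p : ℕ → ℝ) (hp : ∀ n, 0 ≤ p n ∧ p n ≤ 1) (μ ω : ℝ) (hμ : 0 < μ)
    (hμ1 : μ ≤ 1) (hω : 0 ≤ ω) (hω1 : ω ≤ 1) (K : ℝ)
    (hK : K = ∑' x : ℕ × ℕ × ℕ, 1 / (Nat.factorial x.1 : ℝ) *
      (1 / (Nat.factorial x.2.1 : ℝ) * (1 / (Nat.factorial x.2.2 : ℝ)))) :
    ∃ r : ℝ, 0 ≤ r ∧ r ≤ K ∧
      Qp p μ ω 1 = Real.exp (-(μ * (2 - ω))) * (p 1 ^ 2 +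
        μ * (2 * p 2 * p 1 * (1 - ω) + p 2 ^ 2 * ω) + μ ^ 2 * r) := by
  have hω2 : 0 ≤ 1 - ω := by linarith
  set f : ℕ × ℕ × ℕ → ℝ := fun x =>
    p (x.1 + x.2.2 + 1) * p (x.2.1 + x.2.2 + 1) * (μ * (1 - ω)) ^ (x.1 + x.2.1) * (μ * ω) ^ x.2.2 /
        ((Nat.factorial x.1 : ℝ) * (Nat.factorial x.2.1 : ℝ) * (Nat.factorial x.2.2 : ℝ)) with hfdef
  set B : ℕ × ℕ × ℕ → ℝ := fun x => 1 / (Nat.factorial x.1 : ℝ) *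
      (1 / (Nat.factorial x.2.1 : ℝ) * (1 / (Nat.factorial x.2.2 : ℝ))) with hBdef
  have hf : ∀ x, 0 ≤ f x := fun x => by
    have h1 := (hp (x.1 + x.2.2 + 1)).1
    have h2 := (hp (x.2.1 + x.2.2 + 1)).1
    simp only [hfdef]
    positivity
  have hB0 : ∀ x, 0 ≤ B x := fun x => by simp only [hBdef]; positivity
  have hB : Summable B := by
    have h2 := inv_fact_summable.mul_of_nonneg inv_fact_summable (fun n => by positivity)
      (fun n => by positivity)
    exact inv_fact_summable.mul_of_nonneg h2 (fun n => by positivity)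
      (fun n => by simp only [Pi.zero_apply]; positivity)
  have hb : ∀ (x : ℕ × ℕ × ℕ) (N : ℕ), N ≤ x.1 + x.2.1 + x.2.2 → f x ≤ μ ^ N * B x := by
    intro x N hN
    have e1 : (μ * (1 - ω)) ^ (x.1 + x.2.1) * (μ * ω) ^ x.2.2 ≤ μ ^ N := by
      calc (μ * (1 - ω)) ^ (x.1 + x.2.1) * (μ * ω) ^ x.2.2
          ≤ μ ^ (x.1 + x.2.1) * μ ^ x.2.2 := by
            gcongr
            · nlinarith
            · nlinarith
        _ = μ ^ (x.1 + x.2.1 + x.2.2) := by rw [pow_add μ (x.1 + x.2.1)]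
        _ ≤ μ ^ N := pow_le_pow_of_le_one hμ.le hμ1 hN
    have e2 : p (x.1 + x.2.2 + 1) * p (x.2.1 + x.2.2 + 1) ≤ 1 :=
      mul_le_one₀ (hp _).2 (hp _).1 (hp _).2
    have e3 : p (x.1 + x.2.2 + 1) * p (x.2.1 + x.2.2 + 1) *
        ((μ * (1 - ω)) ^ (x.1 + x.2.1) * (μ * ω) ^ x.2.2) ≤ 1 * μ ^ N :=
      mul_le_mul e2 e1 (by positivity) zero_le_one
    have e4 : μ ^ N * B x = (1 * μ ^ N) /
        ((Nat.factorial x.1 : ℝ) * (Nat.factorial x.2.1 : ℝ) * (Nat.factorial x.2.2 : ℝ)) := by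
      simp only [hBdef]
      field_simp
    rw [e4]
    simp only [hfdef]
    rw [mul_assoc (p (x.1 + x.2.2 + 1) * p (x.2.1 + x.2.2 + 1))]
    gcongr
  have hfs : Summable f :=
    Summable.of_nonneg_of_le hf (fun x => by simpa using hb x 0 (Nat.zero_le _)) hB
  obtain ⟨a, b⟩ := tail_bound f B {(0,0,0), (1,0,0), (0,1,0), (0,0,1)} (μ ^ 2) (by positivity)
    hf hfs hB hB0 (fun x hx => hb x 2 (by
      obtain ⟨i, j, k⟩ := x
      simp only [Finset.mem_insert, Finset.mem_singleton, Prod.mk.injEq] at hx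
      simp only
      omega))
  rw [← hK] at b
  have hT : ∑' x, f x = ∑' i : ℕ, ∑' j : ℕ, ∑' k : ℕ,
      p (i + k + 1) * p (j + k + 1) * (μ * (1 - ω)) ^ (i + j) * (μ * ω) ^ k /
        ((Nat.factorial i : ℝ) * (Nat.factorial j : ℝ) * (Nat.factorial k : ℝ)) := by
    rw [hfs.tsum_prod]
    refine tsum_congr fun i => ?_
    rw [(hfs.prod_factor i).tsum_prod]
  set D := ∑' x, f x - ∑ x ∈ ({(0,0,0), (1,0,0), (0,1,0), (0,0,1)} : Finset (ℕ × ℕ × ℕ)), f x with hD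
  refine ⟨D / μ ^ 2, by positivity, by rw [div_le_iff₀ (by positivity)]; linarith, ?_⟩
  have : ∑' x, f x = D + (p 1 ^ 2 + μ * (2 * p 2 * p 1 * (1 - ω) + p 2 ^ 2 * ω)) := by
    rw [hD]
    simp [hfdef]
    ring
  rw [Qp, ← hT, this]
  congr 1
  field_simp
  ring

/-- The final algebraic bound. -/
lemma poly_bound (K : ℝ) (hK : 1 ≤ K) (c q ω μ r1 r2 r3 : ℝ) (hc : 0 ≤ c) (hc1 : c ≤ 1)
    (hq : 0 ≤ q) (hq1 : q ≤ 1) (hω : 0 ≤ ω) (hω1 : ω ≤ 1) (hμ : 0 ≤ μ) (hμ1 : μ ≤ 1)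
    (h1 : |r1| ≤ K) (h2 : |r2| ≤ K) (h3 : |r3| ≤ K) :
    |c ^ 2 * ((1 + μ * ω + μ ^ 2 * r3) *
        (c ^ 2 + μ * (2 * q * c * (1 - ω) + q ^ 2 * ω) + μ ^ 2 * r2))
      - (c ^ 2 + μ * (q * c + ω * (c - q) ^ 2)) * (c + μ * (q / 2) + μ ^ 2 * r1) ^ 2|
      ≤ 100 * K ^ 2 * μ ^ 2 := by
  have bm : ∀ {x y a b : ℝ}, |x| ≤ a → |y| ≤ b → |x * y| ≤ a * b := by
    intro x y a b hx hy
    rw [abs_mul]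
    exact mul_le_mul hx hy (abs_nonneg _) ((abs_nonneg _).trans hx)
  have ba : ∀ {x y a b : ℝ}, |x| ≤ a → |y| ≤ b → |x + y| ≤ a + b := by
    intro x y a b hx hy
    exact (abs_add_le x y).trans (add_le_add hx hy)
  have bs : ∀ {x y a b : ℝ}, |x| ≤ a → |y| ≤ b → |x - y| ≤ a + b := by
    intro x y a b hx hy
    exact (abs_sub x y).trans (add_le_add hx hy)
  have ac : |c| ≤ 1 := abs_le.2 ⟨by linarith, hc1⟩
  have aq : |q| ≤ 1 := abs_le.2 ⟨by linarith, hq1⟩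
  have aω : |ω| ≤ 1 := abs_le.2 ⟨by linarith, hω1⟩
  have aμ : |μ| ≤ 1 := abs_le.2 ⟨by linarith, hμ1⟩
  have aω' : |1 - ω| ≤ 1 := abs_le.2 ⟨by linarith, by linarith⟩
  have acq : |c - q| ≤ 1 := abs_le.2 ⟨by linarith, by linarith⟩
  have ac2 : |c ^ 2| ≤ 1 := by simpa [sq] using bm ac ac
  have aμ2 : |μ ^ 2| ≤ 1 := by simpa [sq] using bm aμ aμ
  obtain ⟨t, ht⟩ : ∃ t, t = 2 * q * c * (1 - ω) + q ^ 2 * ω := ⟨_, rfl⟩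
  have at' : |t| ≤ 3 := by
    rw [ht]
    have := ba (bm (bm (bm (abs_two.le) aq) ac) aω') (bm (bm aq aq) aω)
    rw [sq]
    linarith
  obtain ⟨M, hM⟩ : ∃ M, M = q * c + ω * (c - q) ^ 2 := ⟨_, rfl⟩
  have aM : |M| ≤ 2 := by
    rw [hM, sq]
    have := ba (bm aq ac) (bm aω (bm acq acq))
    linarith
  -- second order form of each factor
  obtain ⟨e, he⟩ : ∃ e, e = ω * t + μ * ω * r2 + r3 * (c ^ 2 + μ * t + μ ^ 2 * r2) := ⟨_, rfl⟩
  have ae : |e| ≤ 3 + K + K * (4 + K) := by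
    rw [he]
    have := ba (ba (bm aω at') (bm (bm aμ aω) h2)) (bm h3 (ba (ba ac2 (bm aμ at')) (bm aμ2 h2)))
    linarith
  have aq2 : |q / 2| ≤ 1 := abs_le.2 ⟨by linarith, by linarith⟩
  obtain ⟨v, hv⟩ : ∃ v, v = q / 2 + μ * r1 := ⟨_, rfl⟩
  have av : |v| ≤ 1 + K := by
    rw [hv]
    have := ba aq2 (bm aμ h1)
    linarith
  obtain ⟨w, hw⟩ : ∃ w, w = 2 * c * r1 + v * v := ⟨_, rfl⟩
  have aw : |w| ≤ 2 * K + (1 + K) * (1 + K) := by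
    rw [hw]
    have := ba (bm (bm (abs_two.le) ac) h1) (bm av av)
    linarith
  have key : c ^ 2 * ((1 + μ * ω + μ ^ 2 * r3) *
        (c ^ 2 + μ * (2 * q * c * (1 - ω) + q ^ 2 * ω) + μ ^ 2 * r2))
      - (c ^ 2 + μ * (q * c + ω * (c - q) ^ 2)) * (c + μ * (q / 2) + μ ^ 2 * r1) ^ 2
      = (c ^ 2 * (e + (r2 + 0)) - (c ^ 2 * w + M * (c * q + μ * w))) * μ ^ 2 := by
    rw [hw, he, hv, hM, ht]
    ring
  rw [key, abs_mul, abs_of_nonneg (sq_nonneg μ)]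
  refine mul_le_mul_of_nonneg_right ?_ (sq_nonneg μ)
  have := bs (bm ac2 (ba ae (ba h2 (abs_zero.le)))) (ba (bm ac2 aw) (bm aM (ba (bm ac aq) (bm aμ aw))))
  nlinarith

theorem contact_regime_asymptotics_p0_zero :
    ∀ c : ℝ, 0 < c →
      ∃ μ₀ : ℝ, 0 < μ₀ ∧ ∃ C : ℝ,
        ∀ (p : ℕ → ℝ), (∀ n, 0 ≤ p n ∧ p n ≤ 1) → p 0 = 0 → p 1 = c →
          ∀ μ : ℝ, 0 < μ → μ ≤ μ₀ → ∀ ω : ℝ, 0 ≤ ω → ω ≤ 1 →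
            0 < mp p μ ∧
            |gp p μ ω 1
                - (μ ^ 2)⁻¹ * (1 + μ * (p 2 / p 1 + ω * (1 - p 2 / p 1) ^ 2))| ≤ C := by
  intro c hc
  obtain ⟨K1, hK1⟩ : ∃ K : ℝ, K = ∑' n : ℕ, 1 / (Nat.factorial n : ℝ) := ⟨_, rfl⟩
  obtain ⟨K2, hK2⟩ : ∃ K : ℝ, K = ∑' x : ℕ × ℕ × ℕ, 1 / (Nat.factorial x.1 : ℝ) *
      (1 / (Nat.factorial x.2.1 : ℝ) * (1 / (Nat.factorial x.2.2 : ℝ))) := ⟨_, rfl⟩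
  obtain ⟨K, hK⟩ : ∃ K : ℝ, K = max 1 (max K1 K2) := ⟨_, rfl⟩
  have k0 : 1 ≤ K := by rw [hK]; exact le_max_left _ _
  have k1 : K1 ≤ K := by rw [hK]; exact (le_max_left _ _).trans (le_max_right _ _)
  have k2 : K2 ≤ K := by rw [hK]; exact (le_max_right _ _).trans (le_max_right _ _)
  refine ⟨1, one_pos, 100 * K ^ 2 / c ^ 4, ?_⟩
  intro p hp h0 h1 μ hμ hμ1 ω hω hω1
  obtain ⟨r1, a1, b1, e1⟩ := m_expand p hp h0 μ hμ hμ1 K1 hK1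
  obtain ⟨r2, a2, b2, e2⟩ := Q_expand p hp μ ω hμ hμ1 hω hω1 K2 hK2
  have hx : |μ * ω| ≤ 1 := by
    rw [abs_of_nonneg (by positivity)]
    nlinarith
  have hexp := Real.abs_exp_sub_one_sub_id_le hx
  obtain ⟨r3, h3⟩ : ∃ r, r = (Real.exp (μ * ω) - 1 - μ * ω) / μ ^ 2 := ⟨_, rfl⟩
  have hr3 : Real.exp (μ * ω) = 1 + μ * ω + μ ^ 2 * r3 := by
    rw [h3]; field_simp; ring
  have b3 : |r3| ≤ K := by
    rw [h3, abs_div, abs_of_pos (show 0 < μ ^ 2 by positivity), div_le_iff₀ (by positivity)]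
    have : (μ * ω) ^ 2 ≤ μ ^ 2 := by
      apply pow_le_pow_left₀ (by positivity); nlinarith
    nlinarith [sq_nonneg μ]
  have hq := hp 2
  have hc1 : c ≤ 1 := h1 ▸ (hp 1).2
  rw [h1] at e1 e2 ⊢
  obtain ⟨q, hqd⟩ : ∃ q, q = p 2 := ⟨_, rfl⟩
  rw [← hqd] at hq e1 e2 ⊢
  have pb := poly_bound K k0 c q ω μ r1 r2 r3 hc.le hc1 hq.1 hq.2 hω hω1 hμ.le hμ1
    (by rw [abs_of_nonneg a1]; linarith) (by rw [abs_of_nonneg a2]; linarith) b3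
  rw [← hr3] at pb
  obtain ⟨a, ha⟩ : ∃ a, a = c + μ * (q / 2) + μ ^ 2 * r1 := ⟨_, rfl⟩
  obtain ⟨T, hT⟩ : ∃ T, T = c ^ 2 + μ * (2 * q * c * (1 - ω) + q ^ 2 * ω) + μ ^ 2 * r2 := ⟨_, rfl⟩
  rw [← ha] at pb e1
  rw [← hT] at pb e2
  have hq0 := hq.1
  have hac : c ≤ a := by
    have : 0 ≤ μ * (q / 2) + μ ^ 2 * r1 := by positivity
    linarith
  have hapos : 0 < a := hc.trans_le hac
  refine ⟨by rw [e1]; positivity, ?_⟩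
  have hE : Real.exp (-(μ * (2 - ω))) = Real.exp (μ * ω) * Real.exp (-μ) ^ 2 := by
    rw [sq, ← Real.exp_add, ← Real.exp_add]; congr 1; ring
  have hid : gp p μ ω 1 - (μ ^ 2)⁻¹ * (1 + μ * (q / c + ω * (1 - q / c) ^ 2))
      = (c ^ 2 * (Real.exp (μ * ω) * T) - (c ^ 2 + μ * (q * c + ω * (c - q) ^ 2)) * a ^ 2)
        / (c ^ 2 * a ^ 2 * μ ^ 2) := by
    have hne := Real.exp_ne_zero (-μ)
    rw [gp, e1, e2, hE]
    field_simp
  rw [hid, abs_div, abs_of_pos (show 0 < c ^ 2 * a ^ 2 * μ ^ 2 by positivity),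
    div_le_div_iff₀ (by positivity) (by positivity)]
  have hca : c ^ 4 ≤ c ^ 2 * a ^ 2 := by
    have : c ^ 2 ≤ a ^ 2 := pow_le_pow_left₀ hc.le hac 2
    nlinarith [sq_nonneg c]
  calc _ ≤ (100 * K ^ 2 * μ ^ 2) * c ^ 4 := by gcongr
    _ ≤ (100 * K ^ 2 * μ ^ 2) * (c ^ 2 * a ^ 2) := by gcongr
    _ = _ := by ring
end

section
/- Poisson Poincaré bound: let θ ≥ 0, let U ~ Poisson(θ), and let f : ℕ → ℝ be bounded. Then Var(f(U)) ≤ θ · (sup_{k ≥ 0} |f(k+1) − f(k)|)². Moreover, if p : ℕ → [0,1], I ∈ ℕ, V ~ Poisson(η) for some η ≥ 0, and G(k) := E[p(k + I + V)], then sup_{k ≥ 0} |G(k+1) − G(k)| ≤ sup_{k ≥ 0} |p(k+1) − p(k)|, so Var(G(U)) ≤ θ · (sup_{k ≥ 0} |p(k+1) − p(k)|)². -/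
open scoped BigOperators

/-- Poisson expectation `E[f(N)] = e^{-θ} ∑ f(n) θⁿ/n!` for `N ~ Poisson(θ)`. -/
noncomputable def epois (θ : ℝ) (f : ℕ → ℝ) : ℝ :=
  Real.exp (-θ) * ∑' n : ℕ, f n * θ ^ n / (Nat.factorial n : ℝ)

/-- Variance of `f(U)` for `U ~ Poisson(θ)`. -/
noncomputable def varPois (θ : ℝ) (f : ℕ → ℝ) : ℝ :=
  epois θ (fun k => (f k) ^ 2) - (epois θ f) ^ 2


lemma pp_hasSum_zero (θ : ℝ) :
    HasSum (fun n : ℕ => θ ^ n / (Nat.factorial n : ℝ)) (Real.exp θ) := by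
  rw [Real.exp_eq_exp_ℝ]
  exact NormedSpace.expSeries_div_hasSum_exp θ

lemma pp_hasSum_shift (θ : ℝ) (h : ℕ → ℝ) (a : ℝ)
    (H : HasSum (fun n : ℕ => h (n + 1) * (θ ^ n / (Nat.factorial n : ℝ))) a) :
    HasSum (fun n : ℕ => (n : ℝ) * h n * (θ ^ n / (Nat.factorial n : ℝ))) (θ * a) := by
  rw [← hasSum_nat_add_iff' 1]
  simp only [Finset.range_one, Finset.sum_singleton, Nat.cast_zero, zero_mul, sub_zero]
  refine (H.mul_left θ).congr_fun ?_
  intro n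
  have h1 : ((n : ℝ) + 1) ≠ 0 := by positivity
  have h2 : (Nat.factorial n : ℝ) ≠ 0 := by positivity
  rw [Nat.factorial_succ]
  push_cast
  field_simp
  ring

lemma pp_hasSum_sq (θ : ℝ) :
    HasSum (fun n : ℕ => ((n : ℝ) - θ) ^ 2 * (θ ^ n / (Nat.factorial n : ℝ)))
      (θ * Real.exp θ) := by
  have h0 := pp_hasSum_zero θ
  have h1 := pp_hasSum_shift θ (fun _ => 1) _ (by simpa using h0)
  have h2 := pp_hasSum_shift θ (fun n => (n : ℝ)) (θ * Real.exp θ + Real.exp θ) (by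
    refine (h1.add h0).congr_fun ?_
    intro n
    push_cast
    ring)
  have h3 := (h2.add (h1.mul_left (-2 * θ))).add (h0.mul_left (θ ^ 2))
  have e : θ * Real.exp θ = θ * (θ * Real.exp θ + Real.exp θ) + -2 * θ * (θ * Real.exp θ)
      + θ ^ 2 * Real.exp θ := by ring
  rw [e]
  refine h3.congr_fun ?_
  intro n
  ring

lemma pp_summable (θ : ℝ) (hθ : 0 ≤ θ) (f : ℕ → ℝ) (M : ℝ) (hM : ∀ k, |f k| ≤ M) :
    Summable (fun n : ℕ => f n * (θ ^ n / (Nat.factorial n : ℝ))) := by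
  refine Summable.of_norm_bounded ((pp_hasSum_zero θ).summable.mul_left M) ?_
  intro n
  have : 0 ≤ θ ^ n / (Nat.factorial n : ℝ) := by positivity
  rw [norm_mul, Real.norm_eq_abs, Real.norm_of_nonneg this]
  exact mul_le_mul_of_nonneg_right (hM n) this

lemma pp_epois (θ : ℝ) (f : ℕ → ℝ) :
    epois θ f = Real.exp (-θ) * ∑' n : ℕ, f n * (θ ^ n / (Nat.factorial n : ℝ)) := by
  simp only [epois, mul_div_assoc]

lemma pp_exp (θ a : ℝ) : Real.exp (-θ) * (a * Real.exp θ) = a := by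
  rw [mul_left_comm, ← Real.exp_add]
  simp

lemma pp_var_le (θ : ℝ) (hθ : 0 ≤ θ) (f : ℕ → ℝ) (M : ℝ) (hM : ∀ k, |f k| ≤ M) (L : ℝ)
    (hL : ∀ k, |f (k + 1) - f k| ≤ L) : varPois θ f ≤ θ * L ^ 2 := by
  have hL0 : 0 ≤ L := (abs_nonneg _).trans (hL 0)
  have lip0 : ∀ k d : ℕ, |f (k + d) - f k| ≤ L * d := by
    intro k d
    induction d with
    | zero => simp
    | succ d ih =>
      have := abs_sub_le (f (k + (d + 1))) (f (k + d)) (f k)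
      have h2 := hL (k + d)
      rw [add_assoc] at h2
      push_cast
      linarith
  have lip : ∀ k m : ℕ, f k - f m ≤ L * |(k : ℝ) - m| := by
    intro k m
    rcases le_total k m with h | h
    · obtain ⟨d, rfl⟩ := Nat.exists_eq_add_of_le h
      have h1 := (abs_le.1 (lip0 k d)).1
      push_cast
      rw [show (k : ℝ) - (k + d) = -d by ring, abs_neg, abs_of_nonneg (by positivity)]
      linarith
    · obtain ⟨d, rfl⟩ := Nat.exists_eq_add_of_le h
      have h1 := (abs_le.1 (lip0 m d)).2
      push_cast
      rw [show (m : ℝ) + d - m = d by ring, abs_of_nonneg (by positivity)]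
      linarith
  obtain ⟨c, hc⟩ : ∃ c : ℝ, ∀ k : ℕ, |f k - c| ≤ L * |(k : ℝ) - θ| := by
    refine ⟨⨆ k : ℕ, (f k - L * |(k : ℝ) - θ|), fun k => ?_⟩
    have hb : BddAbove (Set.range fun k : ℕ => (f k - L * |(k : ℝ) - θ|)) := by
      refine ⟨M, ?_⟩
      rintro _ ⟨k, rfl⟩
      have := (abs_le.1 (hM k)).2
      have h2 : 0 ≤ L * |(k : ℝ) - θ| := by positivity
      simp only
      linarith
    rw [abs_le]
    constructor
    · have : (⨆ k : ℕ, (f k - L * |(k : ℝ) - θ|)) ≤ f k + L * |(k : ℝ) - θ| := by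
        refine ciSup_le fun m => ?_
        have h1 := lip m k
        have h2 := mul_le_mul_of_nonneg_left (abs_sub_le (m : ℝ) θ k) hL0
        rw [abs_sub_comm θ] at h2
        linarith
      linarith
    · have := le_ciSup hb k
      linarith
  have s0 := (pp_hasSum_zero θ)
  have s1 := (pp_summable θ hθ f M hM).hasSum
  have s2 := (pp_summable θ hθ (fun k => f k ^ 2) (M ^ 2) (fun k => by
    rw [abs_pow]
    exact pow_le_pow_left₀ (abs_nonneg _) (hM k) 2)).hasSum
  have s3 := (s2.add (s1.mul_left (-2 * c))).add (s0.mul_left (c ^ 2))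
  have s4 := (pp_hasSum_sq θ).mul_left (L ^ 2)
  have key := hasSum_le (fun n => by
    have hw : 0 ≤ θ ^ n / (Nat.factorial n : ℝ) := by positivity
    have h1 : (f n - c) ^ 2 ≤ L ^ 2 * ((n : ℝ) - θ) ^ 2 := by
      rw [← mul_pow, sq_le_sq, abs_mul, abs_of_nonneg hL0]
      exact hc n
    have h2 := mul_le_mul_of_nonneg_right h1 hw
    linarith) s3 s4
  have k2 := mul_le_mul_of_nonneg_left key (Real.exp_pos (-θ)).le
  rw [mul_add, mul_add, pp_exp, ← mul_assoc (L ^ 2), pp_exp, ← pp_epois θ (fun k => f k ^ 2),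
    mul_left_comm, ← pp_epois θ f] at k2
  unfold varPois
  nlinarith [sq_nonneg (epois θ f - c)]

lemma pp_abs_epois_le (θ : ℝ) (hθ : 0 ≤ θ) (f : ℕ → ℝ) (M : ℝ) (hM : ∀ k, |f k| ≤ M) :
    |epois θ f| ≤ M := by
  have s0 := (pp_hasSum_zero θ).mul_left M
  have s1 := (pp_summable θ hθ f M hM).hasSum
  have hw : ∀ n : ℕ, 0 ≤ θ ^ n / (Nat.factorial n : ℝ) := fun n => by positivity
  have k1 := hasSum_le (fun n => mul_le_mul_of_nonneg_right (abs_le.1 (hM n)).2 (hw n)) s1 s0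
  have k2 := hasSum_le (fun n => by
    have := mul_le_mul_of_nonneg_right (abs_le.1 (hM n)).1 (hw n)
    linarith) s0.neg s1
  have e := (Real.exp_pos (-θ)).le
  have l1 := mul_le_mul_of_nonneg_left k1 e
  have l2 := mul_le_mul_of_nonneg_left k2 e
  rw [pp_exp, ← pp_epois] at l1
  rw [mul_neg, pp_exp, ← pp_epois] at l2
  exact abs_le.2 ⟨l2, l1⟩

lemma pp_epois_sub (θ : ℝ) (hθ : 0 ≤ θ) (f g : ℕ → ℝ) (M : ℝ) (hf : ∀ k, |f k| ≤ M)
    (hg : ∀ k, |g k| ≤ M) : epois θ f - epois θ g = epois θ (fun k => f k - g k) := by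
  simp only [pp_epois, sub_mul]
  rw [(pp_summable θ hθ f M hf).tsum_sub (pp_summable θ hθ g M hg), mul_sub]

lemma pp_le_sup (f : ℕ → ℝ) (M : ℝ) (hM : ∀ k, |f k| ≤ M) (k : ℕ) :
    |f (k + 1) - f k| ≤ ⨆ k : ℕ, |f (k + 1) - f k| := by
  refine le_ciSup (f := fun k : ℕ => |f (k + 1) - f k|) ⟨M + M, ?_⟩ k
  rintro _ ⟨k, rfl⟩
  exact (abs_sub _ _).trans (add_le_add (hM _) (hM _))

theorem poisson_poincare_bound
    (θ : ℝ) (hθ : 0 ≤ θ) :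
    (∀ f : ℕ → ℝ, (∃ M : ℝ, ∀ k, |f k| ≤ M) →
      varPois θ f ≤ θ * (⨆ k : ℕ, |f (k + 1) - f k|) ^ 2) ∧
    (∀ (p : ℕ → ℝ), (∀ n, 0 ≤ p n ∧ p n ≤ 1) → ∀ I : ℕ, ∀ η : ℝ, 0 ≤ η →
      ∀ G : ℕ → ℝ, (∀ k, G k = epois η (fun v => p (k + I + v))) →
        (⨆ k : ℕ, |G (k + 1) - G k|) ≤ (⨆ k : ℕ, |p (k + 1) - p k|) ∧
        varPois θ G ≤ θ * (⨆ k : ℕ, |p (k + 1) - p k|) ^ 2) := by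
  refine ⟨?_, ?_⟩
  · rintro f ⟨M, hM⟩
    exact pp_var_le θ hθ f M hM _ (pp_le_sup f M hM)
  · intro p hp I η hη G hG
    have hp1 : ∀ n, |p n| ≤ 1 := fun n => abs_le.2 ⟨by linarith [(hp n).1], (hp n).2⟩
    have hG1 : ∀ n, |G n| ≤ 1 := fun n => by
      rw [hG]
      exact pp_abs_epois_le η hη _ 1 (fun v => hp1 _)
    have hd : ∀ k, |G (k + 1) - G k| ≤ ⨆ k : ℕ, |p (k + 1) - p k| := by
      intro k
      rw [hG, hG, pp_epois_sub η hη _ _ 1 (fun v => hp1 _) (fun v => hp1 _)]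
      refine pp_abs_epois_le η hη _ _ (fun v => ?_)
      have := pp_le_sup p 1 hp1 (k + I + v)
      rwa [show k + I + v + 1 = k + 1 + I + v by ring] at this
    exact ⟨ciSup_le hd, pp_var_le θ hθ G 1 hG1 _ hd⟩
end

section
/- Let p : ℕ → [0,1] with ‖Δp‖∞ := sup_{k ≥ 0} |p(k+1) − p(k)| < ∞, let μ > 0 with m_p(μ) > 0, let ω ∈ [0,1] and I ∈ {0,1}. Then the pair-correlation value satisfies the pointwise bound |g_p(μ,ω,I) − 1| ≤ μ·ω·‖Δp‖∞²/m_p(μ)² + I·|m₊(μ)²/m_p(μ)² − 1|. -/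
open scoped BigOperators

/-- Shifted Poisson expectation `m₊(t) = E[p(N+1)]` for `N ~ Poisson(t)`. -/
noncomputable def mplus (p : ℕ → ℝ) (t : ℝ) : ℝ :=
  Real.exp (-t) * ∑' n : ℕ, p (n + 1) * t ^ n / (Nat.factorial n : ℝ)

lemma hs_congr {f g : ℕ → ℝ} {a b : ℝ} (h : HasSum f a) (hfg : ∀ n, g n = f n) (hab : b = a) :
    HasSum g b := by
  rw [funext hfg, hab]; exact h

/-- Poisson weight. -/
noncomputable def pw (t : ℝ) (n : ℕ) : ℝ := Real.exp (-t) * t ^ n / (Nat.factorial n : ℝ)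

lemma pw_nonneg {t : ℝ} (ht : 0 ≤ t) (n : ℕ) : 0 ≤ pw t n := by
  unfold pw; positivity

lemma pw_hasSum (t : ℝ) : HasSum (pw t) 1 := by
  have h := (NormedSpace.expSeries_div_hasSum_exp (𝔸 := ℝ) t).mul_left (Real.exp (-t))
  rw [← Real.exp_eq_exp_ℝ, ← Real.exp_add] at h
  simp only [neg_add_cancel, Real.exp_zero] at h
  exact hs_congr h (fun n => by rw [pw]; ring) rfl

lemma pw_succ (t : ℝ) (n : ℕ) : ((n + 1 : ℕ) : ℝ) * pw t (n + 1) = t * pw t n := by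
  have h1 : ((n : ℝ) + 1) ≠ 0 := by positivity
  have h2 : (Nat.factorial n : ℝ) ≠ 0 := by positivity
  unfold pw
  rw [Nat.factorial_succ]
  push_cast
  field_simp
  ring

lemma pw_mean (t : ℝ) : HasSum (fun n : ℕ => (n : ℝ) * pw t n) t := by
  rw [← hasSum_nat_add_iff' 1]
  have h := (pw_hasSum t).mul_left t
  simp only [Finset.range_one, Finset.sum_singleton, Nat.cast_zero, zero_mul, sub_zero]
  rw [mul_one] at h
  exact hs_congr h (fun n => pw_succ t n) rfl

lemma pw_sq (t : ℝ) : HasSum (fun n : ℕ => (n : ℝ) ^ 2 * pw t n) (t ^ 2 + t) := by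
  rw [← hasSum_nat_add_iff' 1]
  have h := ((pw_mean t).add (pw_hasSum t)).mul_left t
  simp only [Finset.range_one, Finset.sum_singleton, Nat.cast_zero]
  refine hs_congr h (fun n => ?_) (by ring)
  rw [pow_two, mul_assoc, pw_succ]; push_cast; ring

lemma bdd_summable {t : ℝ} (ht : 0 ≤ t) (f : ℕ → ℝ) (hf : ∀ n, |f n| ≤ 1) :
    Summable (fun n => f n * pw t n) := by
  refine Summable.of_norm_bounded (pw_hasSum t).summable (fun n => ?_)
  rw [Real.norm_eq_abs, abs_mul, abs_of_nonneg (pw_nonneg ht n)]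
  exact mul_le_of_le_one_left (pw_nonneg ht n) (hf n)

lemma bdd_summable2 {a b : ℝ} (ha : 0 ≤ a) (hb : 0 ≤ b) (G : ℕ → ℕ → ℝ)
    (hG : ∀ i k, |G i k| ≤ 1) :
    Summable (fun x : ℕ × ℕ => G x.1 x.2 * (pw a x.1 * pw b x.2)) := by
  refine Summable.of_norm_bounded
    ((pw_hasSum a).summable.mul_of_nonneg (pw_hasSum b).summable (pw_nonneg ha) (pw_nonneg hb))
    (fun x => ?_)
  have h0 := mul_nonneg (pw_nonneg ha x.1) (pw_nonneg hb x.2)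
  rw [Real.norm_eq_abs, abs_mul, abs_of_nonneg h0]
  exact mul_le_of_le_one_left h0 (hG _ _)

lemma swap2 {a b : ℝ} (ha : 0 ≤ a) (hb : 0 ≤ b) (G : ℕ → ℕ → ℝ)
    (hG : ∀ i k, |G i k| ≤ 1) :
    ∑' i, ∑' k, G i k * (pw a i * pw b k) = ∑' k, ∑' i, G i k * (pw a i * pw b k) :=
  (Summable.tsum_comm (f := fun i k => G i k * (pw a i * pw b k))
    (bdd_summable2 ha hb G hG)).symm

lemma pw_conv (a b : ℝ) (n : ℕ) :
    ∑ x ∈ Finset.HasAntidiagonal.antidiagonal n, pw a x.1 * pw b x.2 = pw (a + b) n := by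
  unfold pw
  rw [(Commute.all a b).add_pow', neg_add, Real.exp_add, Finset.mul_sum, Finset.sum_div]
  refine Finset.sum_congr rfl (fun x hx => ?_)
  rw [Finset.HasAntidiagonal.mem_antidiagonal] at hx
  subst hx
  have h := Nat.add_choose_mul_factorial_mul_factorial x.1 x.2
  have h' : ((x.1 + x.2).choose x.1 : ℝ) * (x.1.factorial : ℝ) * (x.2.factorial : ℝ)
    = ((x.1 + x.2).factorial : ℝ) := by
    rw [Nat.choose_symm_add]; exact_mod_cast h
  have h1 : (x.1.factorial : ℝ) ≠ 0 := by positivity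
  have h2 : (x.2.factorial : ℝ) ≠ 0 := by positivity
  have h3 : ((x.1 + x.2).factorial : ℝ) ≠ 0 := by positivity
  rw [nsmul_eq_mul]
  field_simp
  rw [← h']
  ring

/-- Conditional expectation. -/
noncomputable def ph (h : ℕ → ℝ) (a : ℝ) (k : ℕ) : ℝ := ∑' i, h (i + k) * pw a i

lemma ph_hasSum {h : ℕ → ℝ} (hh : ∀ n, |h n| ≤ 1) {a : ℝ} (ha : 0 ≤ a) (k : ℕ) :
    HasSum (fun i => h (i + k) * pw a i) (ph h a k) :=
  (bdd_summable ha _ (fun _ => hh _)).hasSum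

lemma ph_abs {h : ℕ → ℝ} (hh : ∀ n, |h n| ≤ 1) {a : ℝ} (ha : 0 ≤ a) (k : ℕ) :
    |ph h a k| ≤ 1 := by
  have H := ph_hasSum hh ha k
  have h1 := hasSum_le (fun i => mul_le_mul_of_nonneg_right (abs_le.1 (hh (i + k))).2
    (pw_nonneg ha i)) H ((pw_hasSum a).mul_left 1)
  have h2 := hasSum_le (fun i => mul_le_mul_of_nonneg_right (abs_le.1 (hh (i + k))).1
    (pw_nonneg ha i)) ((pw_hasSum a).mul_left (-1)) H
  rw [abs_le]
  constructor <;> linarith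

lemma lip {f : ℕ → ℝ} {L : ℝ} (hL : ∀ n, |f (n + 1) - f n| ≤ L) (k d : ℕ) :
    |f (k + d) - f k| ≤ L * d := by
  induction d with
  | zero => simp
  | succ d ih =>
    have h1 := hL (k + d)
    have h2 := abs_sub_le (f (k + d + 1)) (f (k + d)) (f k)
    push_cast
    rw [← add_assoc]
    linarith

lemma lip2 {f : ℕ → ℝ} {L : ℝ} (hL : ∀ n, |f (n + 1) - f n| ≤ L) (k l : ℕ) :
    (f k - f l) ^ 2 ≤ L ^ 2 * ((k : ℝ) - l) ^ 2 := by
  have key : ∀ k d : ℕ, (f (k + d) - f k) ^ 2 ≤ L ^ 2 * (d : ℝ) ^ 2 := by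
    intro k d
    rw [← mul_pow, ← sq_abs]
    exact pow_le_pow_left₀ (abs_nonneg _) (lip hL k d) 2
  rcases le_total k l with h | h
  · obtain ⟨d, rfl⟩ := Nat.exists_eq_add_of_le h
    have := key k d
    push_cast
    nlinarith
  · obtain ⟨d, rfl⟩ := Nat.exists_eq_add_of_le h
    have := key l d
    push_cast
    nlinarith

lemma ph_lip {h : ℕ → ℝ} (hh : ∀ n, |h n| ≤ 1) {a : ℝ} (ha : 0 ≤ a) {L : ℝ}
    (hL : ∀ n, |h (n + 1) - h n| ≤ L) (k : ℕ) : |ph h a (k + 1) - ph h a k| ≤ L := by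
  have H := (ph_hasSum hh ha (k + 1)).sub (ph_hasSum hh ha k)
  have h1 := hasSum_le (fun i => by
    rw [← sub_mul]
    exact mul_le_mul_of_nonneg_right (abs_le.1 (hL (i + k))).2
      (pw_nonneg ha i)) H ((pw_hasSum a).mul_left L)
  have h2 := hasSum_le (fun i => by
    rw [← sub_mul]
    exact mul_le_mul_of_nonneg_right (abs_le.1 (hL (i + k))).1
      (pw_nonneg ha i)) ((pw_hasSum a).mul_left (-L)) H
  rw [abs_le]
  constructor <;> linarith

lemma var_bound {f : ℕ → ℝ} (hf : ∀ n, |f n| ≤ 1) {b : ℝ} (hb : 0 ≤ b) {L : ℝ}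
    (hL : ∀ n, |f (n + 1) - f n| ≤ L) :
    |(∑' k, f k ^ 2 * pw b k) - (∑' k, f k * pw b k) ^ 2| ≤ b * L ^ 2 := by
  have hs1 := (bdd_summable hb f hf).hasSum
  have hs2 := (bdd_summable hb (fun k => f k ^ 2) (fun n => by
    rw [abs_pow]; exact pow_le_one₀ (abs_nonneg _) (hf n))).hasSum
  set S1 := ∑' k, f k * pw b k
  set S2 := ∑' k, f k ^ 2 * pw b k
  have hw := pw_hasSum b
  have e1 : ∀ c : ℝ, HasSum (fun l => (c - f l) ^ 2 * pw b l) (c ^ 2 - 2 * c * S1 + S2) := by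
    intro c
    have := ((hw.mul_left (c ^ 2)).sub (hs1.mul_left (2 * c))).add hs2
    rw [mul_one] at this
    exact hs_congr this (fun l => by ring) rfl
  have e2 : ∀ c : ℝ, HasSum (fun l : ℕ => L ^ 2 * (c - l) ^ 2 * pw b l)
      (L ^ 2 * (c ^ 2 - 2 * c * b + (b ^ 2 + b))) := by
    intro c
    have := (((hw.mul_left (c ^ 2)).sub ((pw_mean b).mul_left (2 * c))).add
      (pw_sq b)).mul_left (L ^ 2)
    rw [mul_one] at this
    exact hs_congr this (fun l => by ring) rfl
  have i1 : ∀ k : ℕ, f k ^ 2 - 2 * f k * S1 + S2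
      ≤ L ^ 2 * ((k : ℝ) ^ 2 - 2 * k * b + (b ^ 2 + b)) := fun k =>
    hasSum_le (fun l => mul_le_mul_of_nonneg_right (lip2 hL k l) (pw_nonneg hb l))
      (e1 (f k)) (e2 k)
  have j1 : HasSum (fun k => (f k ^ 2 - 2 * f k * S1 + S2) * pw b k)
      (S2 - 2 * S1 * S1 + S2 * 1) := by
    exact hs_congr ((hs2.sub (hs1.mul_left (2 * S1))).add (hw.mul_left S2))
      (fun l => by ring) rfl
  have j2 : HasSum (fun k : ℕ => (L ^ 2 * ((k : ℝ) ^ 2 - 2 * k * b + (b ^ 2 + b))) * pw b k)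
      (L ^ 2 * ((b ^ 2 + b) - 2 * b * b + (b ^ 2 + b) * 1)) := by
    exact hs_congr ((((pw_sq b).sub ((pw_mean b).mul_left (2 * b))).add
      (hw.mul_left (b ^ 2 + b))).mul_left (L ^ 2))
      (fun l => by ring) rfl
  have up := hasSum_le (fun k => mul_le_mul_of_nonneg_right (i1 k) (pw_nonneg hb k)) j1 j2
  have lo := (e1 S1).nonneg (fun l => mul_nonneg (sq_nonneg _) (pw_nonneg hb l))
  rw [abs_le]
  constructor
  · have : 0 ≤ b * L ^ 2 := by positivity
    nlinarith
  · nlinarith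

lemma mean_ph {h : ℕ → ℝ} (hh : ∀ n, |h n| ≤ 1) {a b : ℝ} (ha : 0 ≤ a) (hb : 0 ≤ b) :
    ∑' k, ph h a k * pw b k = ∑' n, h n * pw (a + b) n := by
  have hs := bdd_summable2 ha hb (fun i k => h (i + k)) (fun _ _ => hh _)
  have h1 : ∑' k, ph h a k * pw b k = ∑' k, ∑' i, h (i + k) * (pw a i * pw b k) := by
    refine tsum_congr (fun k => ?_)
    rw [ph, ← tsum_mul_right]
    exact tsum_congr (fun i => by ring)
  rw [h1, ← swap2 ha hb (fun i k => h (i + k)) (fun _ _ => hh _), ← hs.tsum_prod]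
  rw [← Finset.HasAntidiagonal.sigmaAntidiagonalEquivProd.tsum_eq]
  refine (Summable.tsum_sigma' (fun n => (hasSum_fintype _).summable)
    (Finset.HasAntidiagonal.sigmaAntidiagonalEquivProd.summable_iff.2 hs)).trans ?_
  refine tsum_congr (fun n => ?_)
  rw [tsum_fintype, ← pw_conv, Finset.mul_sum,
    ← Finset.sum_coe_sort (Finset.HasAntidiagonal.antidiagonal n)]
  refine Finset.sum_congr rfl (fun x _ => ?_)
  have := Finset.HasAntidiagonal.mem_antidiagonal.1 x.2
  simp [Finset.HasAntidiagonal.sigmaAntidiagonalEquivProd, this]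

lemma Q_eq {p : ℕ → ℝ} (I : ℕ) (hh : ∀ n, |p (n + I)| ≤ 1) {μ ω : ℝ} (hμ : 0 ≤ μ)
    (hω0 : 0 ≤ ω) (hω1 : ω ≤ 1) :
    Qp p μ ω I = ∑' k, ph (fun n => p (n + I)) (μ * (1 - ω)) k ^ 2 * pw (μ * ω) k := by
  have ha : 0 ≤ μ * (1 - ω) := mul_nonneg hμ (by linarith)
  have hb : 0 ≤ μ * ω := mul_nonneg hμ hω0
  unfold Qp
  have he : Real.exp (-(μ * (2 - ω))) = Real.exp (-(μ * (1 - ω))) * Real.exp (-(μ * (1 - ω)))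
      * Real.exp (-(μ * ω)) := by
    rw [← Real.exp_add, ← Real.exp_add]; congr 1; ring
  set a := μ * (1 - ω)
  set b := μ * ω
  set h : ℕ → ℝ := fun n => p (n + I) with hdef
  have step1 : Real.exp (-(μ * (2 - ω))) *
    ∑' i : ℕ, ∑' j : ℕ, ∑' k : ℕ,
      p (i + k + I) * p (j + k + I) * a ^ (i + j) * b ^ k /
        ((Nat.factorial i : ℝ) * (Nat.factorial j : ℝ) * (Nat.factorial k : ℝ))
      = ∑' i, pw a i * ∑' j, ∑' k, (h (i + k) * h (j + k)) * (pw a j * pw b k) := by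
    simp only [← tsum_mul_left]
    refine tsum_congr fun i => tsum_congr fun j => tsum_congr fun k => ?_
    rw [he]
    simp only [pw, hdef]
    rw [pow_add]
    field_simp
  rw [step1]
  have b2 : ∀ x y : ℝ, |x| ≤ 1 → |y| ≤ 1 → |x * y| ≤ 1 := fun x y hx hy => by
    rw [abs_mul]; exact mul_le_one₀ hx (abs_nonneg _) hy
  have step2 : ∀ i, pw a i * ∑' j, ∑' k, (h (i + k) * h (j + k)) * (pw a j * pw b k)
      = ∑' k, (h (i + k) * ph h a k) * (pw a i * pw b k) := by
    intro i
    rw [swap2 ha hb (fun j k => h (i + k) * h (j + k)) (fun _ _ => b2 _ _ (hh _) (hh _)),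
      ← tsum_mul_left]
    refine tsum_congr fun k => ?_
    have : (h (i + k) * ph h a k) * (pw a i * pw b k)
      = (pw a i * h (i + k) * pw b k) * ph h a k := by ring
    rw [this, ph, ← tsum_mul_left, ← tsum_mul_left]
    exact tsum_congr fun j => by ring
  rw [tsum_congr step2, swap2 ha hb (fun i k => h (i + k) * ph h a k)
    (fun _ k => b2 _ _ (hh _) (ph_abs (h := h) hh ha k))]
  refine tsum_congr fun k => ?_
  have : ph h a k ^ 2 * pw b k = (ph h a k * pw b k) * ph h a k := by ring
  rw [this]
  conv_rhs => rw [ph.eq_1 h a k]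
  rw [← ph.eq_1 h a k, mul_comm, ph.eq_1 h a k, ← tsum_mul_right]
  rw [← ph.eq_1 h a k]
  exact tsum_congr fun j => by ring

lemma pw_tsum (f : ℕ → ℝ) (t : ℝ) :
    Real.exp (-t) * ∑' n : ℕ, f n * t ^ n / (Nat.factorial n : ℝ) = ∑' n, f n * pw t n := by
  rw [← tsum_mul_left]
  exact tsum_congr fun n => by rw [pw]; ring

lemma Q_bound (p : ℕ → ℝ) (hp : ∀ n, 0 ≤ p n ∧ p n ≤ 1)
    (L : ℝ) (hL : L = ⨆ k : ℕ, |p (k + 1) - p k|)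
    (μ : ℝ) (hμ : 0 < μ) (ω : ℝ) (hω0 : 0 ≤ ω) (hω1 : ω ≤ 1) (I : ℕ) :
    |Qp p μ ω I - (∑' n, p (n + I) * pw μ n) ^ 2| ≤ μ * ω * L ^ 2 := by
  have hh : ∀ n, |p (n + I)| ≤ 1 := fun n =>
    abs_le.2 ⟨by linarith [(hp (n + I)).1], (hp (n + I)).2⟩
  have hbd : BddAbove (Set.range fun k : ℕ => |p (k + 1) - p k|) := by
    refine ⟨1, ?_⟩
    rintro _ ⟨k, rfl⟩
    have h1 := hp k
    have h2 := hp (k + 1)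
    exact abs_le.2 ⟨by linarith, by linarith⟩
  have hl : ∀ n, |p (n + 1 + I) - p (n + I)| ≤ L := fun n => by
    rw [hL, add_right_comm]
    exact le_ciSup hbd (n + I)
  have ha : 0 ≤ μ * (1 - ω) := mul_nonneg hμ.le (by linarith)
  have hb : 0 ≤ μ * ω := mul_nonneg hμ.le hω0
  have hm := mean_ph (h := fun n => p (n + I)) hh ha hb
  rw [show μ * (1 - ω) + μ * ω = μ by ring] at hm
  rw [Q_eq I hh hμ.le hω0 hω1, ← hm]
  exact var_bound (ph_abs hh ha) hb (ph_lip (h := fun n => p (n + I)) hh ha hl)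

theorem pointwise_bound_on_pair_correlation
    (p : ℕ → ℝ) (hp : ∀ n, 0 ≤ p n ∧ p n ≤ 1)
    (L : ℝ) (hL : L = ⨆ k : ℕ, |p (k + 1) - p k|)
    (μ : ℝ) (hμ : 0 < μ) (hmp : 0 < mp p μ)
    (ω : ℝ) (hω0 : 0 ≤ ω) (hω1 : ω ≤ 1) (I : ℕ) (hI : I ≤ 1) :
    |gp p μ ω I - 1|
      ≤ μ * ω * L ^ 2 / (mp p μ) ^ 2
        + (I : ℝ) * |(mplus p μ) ^ 2 / (mp p μ) ^ 2 - 1| := by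
  have hQ := Q_bound p hp L hL μ hμ ω hω0 hω1 I
  have hm2 : 0 < (mp p μ) ^ 2 := by positivity
  set M := ∑' n, p (n + I) * pw μ n with hM
  have h1 : |gp p μ ω I - M ^ 2 / (mp p μ) ^ 2| ≤ μ * ω * L ^ 2 / (mp p μ) ^ 2 := by
    rw [gp, ← sub_div, abs_div, abs_of_pos hm2]
    gcongr
  have h2 : |M ^ 2 / (mp p μ) ^ 2 - 1| ≤ (I : ℝ) * |(mplus p μ) ^ 2 / (mp p μ) ^ 2 - 1| := by
    interval_cases I
    · have : M = mp p μ := by rw [hM, mp, pw_tsum]; rfl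
      rw [this, div_self hm2.ne']
      simp
    · have : M = mplus p μ := by rw [hM, mplus, pw_tsum (fun n => p (n + 1))]
      rw [this]
      simp
  exact (abs_sub_le _ _ _).trans (add_le_add h1 h2)
end

section
/- Count-favouring attraction at contact: let p : ℕ → [0,1] satisfy p(0) > 0 and p(1) > p(0). Then there exists μ₀ > 0 such that for all 0 < μ ≤ μ₀ and all ω ∈ [0,1], one has m_p(μ) > 0 and g_p(μ, ω, 1) > 1; that is, the neighbour-count thinning exhibits attraction (pair correlation exceeding 1) at contact scales ‖h‖ ≤ r for all sufficiently small μ. -/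
open scoped BigOperators

theorem triple_aux (f : ℕ → ℕ → ℕ → ℝ) (A B : ℕ → ℝ)
    (hf : ∀ i j k, 0 ≤ f i j k) (hle : ∀ i j k, f i j k ≤ A i * A j * B k)
    (hA : Summable A) (hB : Summable B) :
    f 0 0 0 ≤ ∑' i, ∑' j, ∑' k, f i j k := by
  have s1 : ∀ i j, Summable (f i j) := fun i j =>
    Summable.of_nonneg_of_le (hf i j) (hle i j) (hB.mul_left _)
  have n1 : ∀ i j, 0 ≤ ∑' k, f i j k := fun i j => tsum_nonneg (hf i j)
  have l1 : ∀ i j, ∑' k, f i j k ≤ A i * A j * ∑' k, B k := fun i j => by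
    rw [← tsum_mul_left]
    exact (s1 i j).tsum_le_tsum (hle i j) (hB.mul_left _)
  have s2 : ∀ i, Summable (fun j => ∑' k, f i j k) := fun i =>
    Summable.of_nonneg_of_le (n1 i) (l1 i) ((hA.mul_left _).mul_right _)
  have n2 : ∀ i, 0 ≤ ∑' j, ∑' k, f i j k := fun i => tsum_nonneg (n1 i)
  have l2 : ∀ i, ∑' j, ∑' k, f i j k ≤ A i * (∑' j, A j) * ∑' k, B k := fun i => by
    rw [← tsum_mul_left (a := A i) (f := A), ← tsum_mul_right]
    exact (s2 i).tsum_le_tsum (l1 i) ((hA.mul_left _).mul_right _)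
  have s3 : Summable (fun i => ∑' j, ∑' k, f i j k) :=
    Summable.of_nonneg_of_le n2 l2 ((hA.mul_right _).mul_right _)
  calc f 0 0 0 ≤ ∑' k, f 0 0 k := (s1 0 0).le_tsum 0 (fun k _ => hf 0 0 k)
    _ ≤ ∑' j, ∑' k, f 0 j k := (s2 0).le_tsum 0 (fun k _ => n1 0 k)
    _ ≤ _ := s3.le_tsum 0 (fun k _ => n2 k)

theorem count_favouring_attraction_at_contact
    (p : ℕ → ℝ) (hp : ∀ n, 0 ≤ p n ∧ p n ≤ 1)
    (h0 : 0 < p 0) (h01 : p 0 < p 1) :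
    ∃ μ₀ : ℝ, 0 < μ₀ ∧
      ∀ μ : ℝ, 0 < μ → μ ≤ μ₀ → ∀ ω : ℝ, 0 ≤ ω → ω ≤ 1 →
        0 < mp p μ ∧ 1 < gp p μ ω 1 := by
  refine ⟨Real.log (1 + (p 1 - p 0) / 2), Real.log_pos (by linarith), ?_⟩
  intro μ hμ hμ0 ω hω0 hω1
  have he : Real.exp μ ≤ 1 + (p 1 - p 0) / 2 := by
    rw [← Real.exp_log (show (0:ℝ) < 1 + (p 1 - p 0) / 2 by linarith)]
    exact Real.exp_le_exp.2 hμ0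
  have hsE : Summable (fun n : ℕ => μ ^ n / (Nat.factorial n : ℝ)) :=
    Real.summable_pow_div_factorial μ
  have hE : ∑' n : ℕ, μ ^ n / (Nat.factorial n : ℝ) = Real.exp μ := by
    rw [Real.exp_eq_exp_ℝ, NormedSpace.exp_eq_tsum_div]
  have hn : ∀ n : ℕ, 0 ≤ p n * μ ^ n / (Nat.factorial n : ℝ) := fun n => by
    have := (hp n).1
    positivity
  have hl : ∀ n : ℕ, p n * μ ^ n / (Nat.factorial n : ℝ) ≤ μ ^ n / (Nat.factorial n : ℝ) :=
    fun n => by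
      have h1 : p n * μ ^ n ≤ μ ^ n := mul_le_of_le_one_left (by positivity) (hp n).2
      gcongr
  have hs : Summable (fun n : ℕ => p n * μ ^ n / (Nat.factorial n : ℝ)) :=
    Summable.of_nonneg_of_le hn hl hsE
  set S := ∑' n : ℕ, p n * μ ^ n / (Nat.factorial n : ℝ) with hS
  have hS0 : p 0 ≤ S := by
    have := hs.le_tsum 0 (fun k _ => hn k)
    simpa using this
  have hS1 : S ≤ p 0 + (Real.exp μ - 1) := by
    rw [hs.tsum_eq_zero_add] at hS
    rw [hsE.tsum_eq_zero_add] at hE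
    have h2 := ((summable_nat_add_iff 1).2 hs).tsum_le_tsum (fun n => hl (n + 1))
      ((summable_nat_add_iff 1).2 hsE)
    simp only [pow_zero, Nat.factorial_zero, Nat.cast_one, mul_one, div_one] at hS hE
    linarith
  have hm : 0 < mp p μ := mul_pos (Real.exp_pos _) (by linarith)
  refine ⟨hm, ?_⟩
  have ha : 0 ≤ μ * (1 - ω) := mul_nonneg hμ.le (by linarith)
  have hb : 0 ≤ μ * ω := mul_nonneg hμ.le hω0
  have hT := triple_aux (fun i j k => p (i + k + 1) * p (j + k + 1) * (μ * (1 - ω)) ^ (i + j)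
      * (μ * ω) ^ k / ((Nat.factorial i : ℝ) * (Nat.factorial j : ℝ) * (Nat.factorial k : ℝ)))
    (fun n => (μ * (1 - ω)) ^ n / (Nat.factorial n : ℝ))
    (fun n => (μ * ω) ^ n / (Nat.factorial n : ℝ))
    (fun i j k => by
      have h1 := (hp (i + k + 1)).1
      have h2 := (hp (j + k + 1)).1
      have h3 := pow_nonneg ha (i + j)
      have h4 := pow_nonneg hb k
      exact div_nonneg (mul_nonneg (mul_nonneg (mul_nonneg h1 h2) h3) h4) (by positivity))
    (fun i j k => by
      have h1 := hp (i + k + 1)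
      have h2 := hp (j + k + 1)
      have h3 := pow_nonneg ha (i + j)
      have h4 := pow_nonneg hb k
      have h5 : p (i + k + 1) * p (j + k + 1) ≤ 1 := mul_le_one₀ h1.2 h2.1 h2.2
      have h6 : p (i + k + 1) * p (j + k + 1) * (μ * (1 - ω)) ^ (i + j) * (μ * ω) ^ k
          ≤ (μ * (1 - ω)) ^ (i + j) * (μ * ω) ^ k :=
        mul_le_mul_of_nonneg_right (mul_le_of_le_one_left h3 h5) h4
      rw [div_mul_div_comm, div_mul_div_comm, ← pow_add]
      gcongr)
    (Real.summable_pow_div_factorial _) (Real.summable_pow_div_factorial _)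
  have hQ : Real.exp (-(μ * (2 - ω))) * (p 1 * p 1) ≤ Qp p μ ω 1 := by
    unfold Qp
    refine mul_le_mul_of_nonneg_left ?_ (Real.exp_pos _).le
    simpa using hT
  unfold gp
  rw [one_lt_div (by positivity)]
  refine lt_of_lt_of_le ?_ hQ
  have hm2 : mp p μ ^ 2 = Real.exp (-(2 * μ)) * (S * S) := by
    unfold mp
    rw [← hS, show -(2 * μ) = -μ + -μ by ring, Real.exp_add]
    ring
  rw [hm2]
  have hexp : Real.exp (-(2 * μ)) ≤ Real.exp (-(μ * (2 - ω))) :=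
    Real.exp_le_exp.2 (by nlinarith)
  have hSp : S < p 1 := by linarith
  have hSS : S * S < p 1 * p 1 := by nlinarith
  calc Real.exp (-(2 * μ)) * (S * S) < Real.exp (-(2 * μ)) * (p 1 * p 1) :=
        mul_lt_mul_of_pos_left hSS (Real.exp_pos _)
    _ ≤ _ := mul_le_mul_of_nonneg_right hexp (mul_self_nonneg _)
end

section
/- Geometric soft-core rule: fix q ∈ (0,1] and s ∈ (0,1) and let p(n) := q·sⁿ. Then there exist constants μ₀ > 0 and C < ∞, depending only on q and s, such that for all 0 < μ ≤ μ₀ and all ω ∈ [0,1]: (i) |g_p(μ, ω, 0) − 1 − μ·ω·(1 − s)²| ≤ C·μ² (ring attraction on r < ‖h‖ ≤ 2r), and (ii) |g_p(μ, ω, 1) − s²·(1 + μ·ω·(1 − s)²)| ≤ C·μ² (so g_p(μ, ω, 1) < 1 for all sufficiently small μ: repulsion at contact ‖h‖ ≤ r). -/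
open scoped BigOperators

theorem tsum_exp_aux (c x : ℝ) : ∑' n : ℕ, c * (x ^ n / (Nat.factorial n : ℝ)) = c * Real.exp x := by
  rw [tsum_mul_left, Real.exp_eq_exp_ℝ, NormedSpace.exp_eq_tsum_div]

theorem mp_geom (q s t : ℝ) (p : ℕ → ℝ) (hp : ∀ n, p n = q * s ^ n) :
    mp p t = q * Real.exp (-(t * (1 - s))) := by
  unfold mp
  have h : ∀ n : ℕ, p n * t ^ n / (Nat.factorial n : ℝ)
      = q * ((s * t) ^ n / (Nat.factorial n : ℝ)) := by
    intro n
    rw [hp, mul_pow]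
    ring
  simp_rw [h]
  rw [tsum_exp_aux, mul_left_comm, ← Real.exp_add]
  ring_nf

theorem Qp_geom (q s μ ω : ℝ) (I : ℕ) (p : ℕ → ℝ) (hp : ∀ n, p n = q * s ^ n) :
    Qp p μ ω I = q ^ 2 * s ^ (2 * I) *
      Real.exp (-(2 * (μ * (1 - s))) + μ * ω * (1 - s) ^ 2) := by
  unfold Qp
  have h : ∀ i j k : ℕ,
      p (i + k + I) * p (j + k + I) * (μ * (1 - ω)) ^ (i + j) * (μ * ω) ^ k /
        ((Nat.factorial i : ℝ) * (Nat.factorial j : ℝ) * (Nat.factorial k : ℝ))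
      = (q ^ 2 * s ^ (2 * I) * ((s * (μ * (1 - ω))) ^ i / (Nat.factorial i : ℝ))
          * ((s * (μ * (1 - ω))) ^ j / (Nat.factorial j : ℝ)))
        * ((s ^ 2 * (μ * ω)) ^ k / (Nat.factorial k : ℝ)) := by
    intro i j k
    have hi : (Nat.factorial i : ℝ) ≠ 0 := by positivity
    have hj : (Nat.factorial j : ℝ) ≠ 0 := by positivity
    have hk : (Nat.factorial k : ℝ) ≠ 0 := by positivity
    rw [hp, hp, mul_pow s, mul_pow s, mul_pow (s ^ 2)]
    generalize μ * (1 - ω) = a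
    generalize μ * ω = b
    field_simp
    ring
  simp_rw [h, tsum_exp_aux]
  have h2 : ∀ i j : ℕ,
      q ^ 2 * s ^ (2 * I) * ((s * (μ * (1 - ω))) ^ i / (Nat.factorial i : ℝ))
          * ((s * (μ * (1 - ω))) ^ j / (Nat.factorial j : ℝ)) * Real.exp (s ^ 2 * (μ * ω))
      = (q ^ 2 * s ^ (2 * I) * Real.exp (s ^ 2 * (μ * ω)) *
          ((s * (μ * (1 - ω))) ^ i / (Nat.factorial i : ℝ)))
          * ((s * (μ * (1 - ω))) ^ j / (Nat.factorial j : ℝ)) := by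
    intro i j
    ring
  simp_rw [h2, tsum_exp_aux]
  rw [tsum_mul_right, tsum_exp_aux]
  have h3 : -(2 * (μ * (1 - s))) + μ * ω * (1 - s) ^ 2
      = -(μ * (2 - ω)) + s ^ 2 * (μ * ω) + s * (μ * (1 - ω)) + s * (μ * (1 - ω)) := by ring
  rw [h3, Real.exp_add, Real.exp_add, Real.exp_add]
  ring

theorem gp_geom (q s μ ω : ℝ) (hq : 0 < q) (I : ℕ) (p : ℕ → ℝ) (hp : ∀ n, p n = q * s ^ n) :
    gp p μ ω I = s ^ (2 * I) * Real.exp (μ * ω * (1 - s) ^ 2) := by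
  unfold gp
  rw [Qp_geom q s μ ω I p hp, mp_geom q s μ p hp, Real.exp_add, mul_pow, ← Real.exp_nat_mul]
  have : ((2 : ℕ) : ℝ) * -(μ * (1 - s)) = -(2 * (μ * (1 - s))) := by push_cast; ring
  rw [this]
  have := Real.exp_ne_zero (-(2 * (μ * (1 - s))))
  field_simp

theorem geometric_softcore_pair_correlation
    (q s : ℝ) (hq0 : 0 < q) (hq1 : q ≤ 1) (hs0 : 0 < s) (hs1 : s < 1)
    (p : ℕ → ℝ) (hpdef : ∀ n, p n = q * s ^ n) :
    ∃ μ₀ : ℝ, 0 < μ₀ ∧ ∃ C : ℝ,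
      ∀ μ : ℝ, 0 < μ → μ ≤ μ₀ → ∀ ω : ℝ, 0 ≤ ω → ω ≤ 1 →
        |gp p μ ω 0 - 1 - μ * ω * (1 - s) ^ 2| ≤ C * μ ^ 2 ∧
        |gp p μ ω 1 - s ^ 2 * (1 + μ * ω * (1 - s) ^ 2)| ≤ C * μ ^ 2 := by
  refine ⟨1, one_pos, 1, ?_⟩
  intro μ hμ hμ1 ω hω hω1
  rw [gp_geom q s μ ω hq0 0 p hpdef, gp_geom q s μ ω hq0 1 p hpdef]
  have hu0 : 0 ≤ (1 - s) ^ 2 := by positivity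
  have hu1 : (1 - s) ^ 2 ≤ 1 := by nlinarith
  have hx0 : 0 ≤ μ * ω * (1 - s) ^ 2 := by positivity
  have hxμ : μ * ω * (1 - s) ^ 2 ≤ μ := by
    calc μ * ω * (1 - s) ^ 2 ≤ μ * 1 * 1 := by gcongr
      _ = μ := by ring
  generalize μ * ω * (1 - s) ^ 2 = x at *
  have hx : |Real.exp x - 1 - x| ≤ x ^ 2 :=
    Real.abs_exp_sub_one_sub_id_le (by rw [abs_of_nonneg hx0]; linarith)
  have hx2 : x ^ 2 ≤ μ ^ 2 := by gcongr
  constructor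
  · simpa using hx.trans hx2
  · have he : s ^ (2 * 1) * Real.exp x - s ^ 2 * (1 + x) = s ^ 2 * (Real.exp x - 1 - x) := by ring
    rw [he, abs_mul, abs_of_nonneg (by positivity : (0:ℝ) ≤ s ^ 2)]
    have hs2 : s ^ 2 ≤ 1 := by nlinarith
    calc s ^ 2 * |Real.exp x - 1 - x| ≤ 1 * μ ^ 2 := by
          gcongr
          exact hx.trans hx2
end
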